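/- arXiv:1404.3508 — 3 statements merged into one kernel-verified Lean document; each statement's English description precedes it below -/
import Mathlib

section
/- For every ε > 0 there is a constant C(ε) such that for all real X ≥ 1 one has J_{3,2}(X) ≤ C(ε) · X^{3+ε}; that is, the number of integer solutions of the simultaneous equations x_1² + x_2² + x_3² = y_1² + y_2² + y_3² and x_1 + x_2 + x_3 = y_1 + y_2 + y_3 with 1 ≤ x_i, y_i ≤ X is at most C(ε) · X^{3+ε}. -/
/-- `J s k X` counts the 2s-tuples of integers `(x₁,…,x_s,y₁,…,y_s)` with
`1 ≤ xᵢ, yᵢ ≤ X` satisfying `x₁^j + … + x_s^j = y₁^j + … + y_s^j` for `1 ≤ j ≤ k`. -/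
noncomputable def J (s k : ℕ) (X : ℝ) : ℕ :=
  Set.ncard {p : (Fin s → ℤ) × (Fin s → ℤ) |
    (∀ i, 1 ≤ p.1 i ∧ (p.1 i : ℝ) ≤ X) ∧ (∀ i, 1 ≤ p.2 i ∧ (p.2 i : ℝ) ≤ X) ∧
    ∀ j ∈ Finset.Icc 1 k, ∑ i, p.1 i ^ j = ∑ i, p.2 i ^ j}

namespace MCQ

def D0 (N : ℕ) : Finset (ℕ × ℕ) :=
  (Finset.range (N+1) ×ˢ Finset.range (N+1)).filter (fun p => p.1 * p.2 ≤ N)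

noncomputable def E (N : ℕ) : Finset (ℤ × ℤ) :=
  (Finset.Icc (-(N:ℤ)) N ×ˢ Finset.Icc (-(N:ℤ)) N).filter (fun p => |p.1 * p.2| ≤ N)

theorem mem_E (N : ℕ) (a b : ℤ) : (a, b) ∈ E N ↔ |a| ≤ N ∧ |b| ≤ N ∧ |a * b| ≤ N := by
  simp [E, abs_le, and_assoc]

theorem card_D0 (N : ℕ) (hN : 1 ≤ N) : ((D0 N).card : ℝ) ≤ 2 * N * (2 + Real.log N) := by
  have hN' : (1:ℝ) ≤ N := by exact_mod_cast hN
  have h1 : (D0 N).card = ∑ m ∈ Finset.range (N+1),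
      ((Finset.range (N+1)).filter (fun n => m * n ≤ N)).card := by
    rw [D0, Finset.card_filter, Finset.sum_product]
    exact Finset.sum_congr rfl fun m _ => (Finset.card_filter _ _).symm
  have h2 : ∀ m ∈ Finset.range N,
      ((((Finset.range (N+1)).filter (fun n => (m+1) * n ≤ N)).card : ℕ) : ℝ)
        ≤ 2 * N * ((m+1 : ℕ) : ℝ)⁻¹ := by
    intro m hm
    have hm' : m + 1 ≤ N := Finset.mem_range.mp hm
    have h3 : ((Finset.range (N+1)).filter (fun n => (m+1) * n ≤ N)).card ≤ N / (m+1) + 1 := by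
      calc _ ≤ (Finset.range (N/(m+1) + 1)).card := by
            apply Finset.card_le_card
            intro n hn
            simp only [Finset.mem_filter, Finset.mem_range] at hn ⊢
            apply Nat.lt_succ_of_le
            rw [Nat.le_div_iff_mul_le (Nat.succ_pos m), mul_comm]
            exact hn.2
        _ = _ := by simp
    have h4 : N / (m+1) + 1 ≤ 2 * (N / (m+1)) := by
      have : 1 ≤ N / (m+1) := Nat.div_pos hm' (Nat.succ_pos m)
      omega
    have h5 : ((N / (m+1) : ℕ) : ℝ) ≤ N / ((m+1 : ℕ) : ℝ) := Nat.cast_div_le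
    calc _ ≤ ((2 * (N / (m+1)) : ℕ) : ℝ) := by exact_mod_cast h3.trans h4
      _ = 2 * ((N / (m+1) : ℕ) : ℝ) := by push_cast; ring
      _ ≤ 2 * (N / ((m+1 : ℕ) : ℝ)) := by linarith
      _ = _ := by rw [div_eq_mul_inv]; ring
  have h6 : ∑ m ∈ Finset.range N, (((m+1 : ℕ) : ℝ))⁻¹ ≤ 1 + Real.log N := by
    have := harmonic_le_one_add_log N
    simpa [harmonic] using this
  rw [h1, Finset.sum_range_succ']
  push_cast
  have h7 := Finset.sum_le_sum h2
  rw [← Finset.mul_sum] at h7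
  have h8 : ((((Finset.range (N+1)).filter (fun n => 0 * n ≤ N)).card : ℕ) : ℝ) ≤ 2 * N := by
    simp; linarith
  have h9 : 2 * (N:ℝ) * ∑ m ∈ Finset.range N, (((m+1 : ℕ) : ℝ))⁻¹
      ≤ 2 * N * (1 + Real.log N) := by gcongr
  linarith

theorem card_E (N : ℕ) : (E N).card ≤ 4 * (D0 N).card := by
  have hs : E N ⊆ ((({1, -1} : Finset ℤ) ×ˢ ({1, -1} : Finset ℤ)) ×ˢ D0 N).image
      (fun q => (q.1.1 * (q.2.1 : ℤ), q.1.2 * (q.2.2 : ℤ))) := by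
    rintro ⟨a, b⟩ h
    rw [mem_E] at h
    obtain ⟨ha, hb, hab⟩ := h
    rw [Int.abs_eq_natAbs] at ha hb hab
    have key : ∀ z : ℤ, ∃ s ∈ ({1, -1} : Finset ℤ), s * (z.natAbs : ℤ) = z := by
      intro z
      rcases abs_choice z with h | h
      · exact ⟨1, by simp, by simp [h]⟩
      · exact ⟨-1, by simp, by simp [h]⟩
    obtain ⟨s, hs, hsa⟩ := key a
    obtain ⟨t, ht, htb⟩ := key b
    refine Finset.mem_image.mpr ⟨((s, t), (a.natAbs, b.natAbs)), ?_, by simp only [hsa, htb]⟩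
    simp only [Finset.mem_product, D0, Finset.mem_filter, Finset.mem_range]
    refine ⟨⟨hs, ht⟩, ⟨by omega, by omega⟩, ?_⟩
    rw [← Int.natAbs_mul]; omega
  refine (Finset.card_le_card hs).trans (Finset.card_image_le.trans ?_)
  rw [Finset.card_product, Finset.card_product]
  simp

def fac (q : (ℤ × ℤ) × (ℤ × ℤ)) : (ℤ × ℤ) × (ℤ × ℤ) :=
  ((q.1.1 * q.1.2, q.2.1 * q.2.2), (q.1.1 * q.2.1, q.1.2 * q.2.2))

noncomputable def Q (N : ℕ) : Finset ((ℤ × ℤ) × (ℤ × ℤ)) :=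
  (E N ×ˢ E N).image fac ∪ (E N ×ˢ E N)

theorem card_Q (N : ℕ) : (Q N).card ≤ 2 * (E N).card ^ 2 := by
  have h1 := Finset.card_union_le ((E N ×ˢ E N).image fac) (E N ×ˢ E N)
  have h2 := Finset.card_image_le (s := E N ×ˢ E N) (f := fac)
  rw [Finset.card_product] at h1 h2
  rw [Q, pow_two]
  omega

theorem mem_Q (N : ℕ) (a b c d : ℤ) (ha : |a| ≤ N) (hb : |b| ≤ N) (hc : |c| ≤ N) (hd : |d| ≤ N)
    (h : a * b = c * d) : ((a, b), (c, d)) ∈ Q N := by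
  by_cases h0 : a * b = 0
  · apply Finset.mem_union_right
    rw [Finset.mem_product]
    refine ⟨(mem_E _ _ _).2 ⟨ha, hb, by simp [h0]⟩, (mem_E _ _ _).2 ⟨hc, hd, by simp [← h, h0]⟩⟩
  · apply Finset.mem_union_left
    have hdvd : c ∣ a * b := ⟨d, h⟩
    obtain ⟨g, v, ⟨u, rfl⟩, ⟨t, rfl⟩, rfl⟩ := exists_dvd_and_dvd_of_dvd_mul hdvd
    have hg : g ≠ 0 := by rintro rfl; simp at h0
    have hu : u ≠ 0 := by rintro rfl; simp at h0
    have hv : v ≠ 0 := by rintro rfl; simp at h0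
    have ht : t ≠ 0 := by rintro rfl; simp at h0
    have hd' : u * t = d := by
      apply mul_left_cancel₀ (mul_ne_zero hg hv)
      rw [← h]; ring
    have key : ∀ x y : ℤ, x ≠ 0 → y ≠ 0 → |x * y| ≤ N → (x, y) ∈ E N := by
      intro x y hx hy hxy
      have h1 : 1 ≤ |x| := Int.one_le_abs hx
      have h2 : 1 ≤ |y| := Int.one_le_abs hy
      have h3 := hxy
      rw [abs_mul] at h3
      exact (mem_E _ _ _).2 ⟨by nlinarith, by nlinarith, hxy⟩
    refine Finset.mem_image.mpr ⟨((g, u), (v, t)), ?_, by simp [fac, hd']⟩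
    exact Finset.mem_product.2 ⟨key _ _ hg hu ha, key _ _ hv ht hb⟩

def F (p : ℤ × ((ℤ × ℤ) × (ℤ × ℤ))) : (Fin 3 → ℤ) × (Fin 3 → ℤ) :=
  let y := p.1
  let a := p.2.1.1
  let b := p.2.1.2
  let c := p.2.2.1
  let d := p.2.2.2
  let z := a + b + y - c - d
  (![a + y, b + y, z], ![y, c + z, d + z])

theorem J_le (X : ℝ) (hX : 1 ≤ X) : J 3 2 X ≤ ⌊X⌋₊ * (Q ⌊X⌋₊).card := by
  set N := ⌊X⌋₊ with hN
  have hsub : {p : (Fin 3 → ℤ) × (Fin 3 → ℤ) |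
    (∀ i, 1 ≤ p.1 i ∧ (p.1 i : ℝ) ≤ X) ∧ (∀ i, 1 ≤ p.2 i ∧ (p.2 i : ℝ) ≤ X) ∧
    ∀ j ∈ Finset.Icc 1 2, ∑ i, p.1 i ^ j = ∑ i, p.2 i ^ j} ⊆
      (((Finset.Icc 1 (N:ℤ) ×ˢ Q N).image F : Finset _) : Set _) := by
    rintro ⟨x, y⟩ ⟨hx, hy, hj⟩
    have hle : ∀ z : ℤ, (z:ℝ) ≤ X → z ≤ N := by
      intro z hz
      have := Int.le_floor.2 hz
      rwa [← Int.natCast_floor_eq_floor (by linarith)] at this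
    have h1 := hj 1 (by simp)
    have h2 := hj 2 (by simp)
    simp only [Fin.sum_univ_three, pow_one] at h1 h2
    have hx' : ∀ i, 1 ≤ x i ∧ x i ≤ N := fun i => ⟨(hx i).1, hle _ (hx i).2⟩
    have hy' : ∀ i, 1 ≤ y i ∧ y i ≤ N := fun i => ⟨(hy i).1, hle _ (hy i).2⟩
    have x0 := hx' 0
    have x1 := hx' 1
    have x2 := hx' 2
    have y0 := hy' 0
    have y1 := hy' 1
    have y2 := hy' 2
    rw [Finset.mem_coe, Finset.mem_image]
    refine ⟨(y 0, ((x 0 - y 0, x 1 - y 0), (y 1 - x 2, y 2 - x 2))), ?_, ?_⟩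
    · rw [Finset.mem_product]
      refine ⟨Finset.mem_Icc.2 y0, mem_Q _ _ _ _ _ ?_ ?_ ?_ ?_ ?_⟩
      · rw [abs_le]; constructor <;> omega
      · rw [abs_le]; constructor <;> omega
      · rw [abs_le]; constructor <;> omega
      · rw [abs_le]; constructor <;> omega
      · have h3 : x 0 = y 0 + y 1 + y 2 - x 1 - x 2 := by linarith
        rw [h3] at h2 ⊢
        linarith
    · have hz : x 0 - y 0 + (x 1 - y 0) + y 0 - (y 1 - x 2) - (y 2 - x 2) = x 2 := by linarith
      simp only [F, hz]
      ext i
      · fin_cases i <;> simp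
      · fin_cases i <;> simp
  unfold J
  refine (Set.ncard_le_ncard hsub (Finset.finite_toSet _)).trans ?_
  rw [Set.ncard_coe_finset]
  refine Finset.card_image_le.trans ?_
  rw [Finset.card_product]
  simp

end MCQ

theorem main_conjecture_quadratic (ε : ℝ) (hε : ε > 0) :
    ∃ C : ℝ, ∀ X : ℝ, X ≥ 1 → (J 3 2 X : ℝ) ≤ C * X ^ (3 + ε) := by
  refine ⟨128 * (2 + 2 / ε) ^ 2, fun X hX => ?_⟩
  have hJ := MCQ.J_le X hX
  have hQ := MCQ.card_Q ⌊X⌋₊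
  have hE := MCQ.card_E ⌊X⌋₊
  have hN1 : 1 ≤ ⌊X⌋₊ := Nat.le_floor (by simpa using hX)
  have hD := MCQ.card_D0 ⌊X⌋₊ hN1
  have hNX : (⌊X⌋₊ : ℝ) ≤ X := Nat.floor_le (by linarith)
  set N := ⌊X⌋₊
  have hN1' : (1:ℝ) ≤ N := by exact_mod_cast hN1
  have hX0 : 0 < X := by linarith
  have hlog : Real.log N ≤ X ^ (ε/2) / (ε/2) :=
    (Real.log_le_log (by linarith) hNX).trans (Real.log_le_rpow_div hX0.le (by positivity))
  have hone : 1 ≤ X ^ (ε/2) := Real.one_le_rpow hX (by positivity)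
  have hL : 2 + Real.log N ≤ (2 + 2/ε) * X ^ (ε/2) := by
    have : X ^ (ε/2) / (ε/2) = 2/ε * X ^ (ε/2) := by field_simp
    rw [this] at hlog
    linarith
  have hl0 : 0 ≤ Real.log N := Real.log_nonneg hN1'
  have hEr : ((MCQ.E N).card : ℝ) ≤ 8 * X * ((2 + 2/ε) * X ^ (ε/2)) := by
    calc ((MCQ.E N).card : ℝ) ≤ 4 * ((MCQ.D0 N).card : ℝ) := by exact_mod_cast hE
      _ ≤ 4 * (2 * N * (2 + Real.log N)) := by linarith
      _ ≤ 4 * (2 * X * ((2 + 2/ε) * X ^ (ε/2))) := by gcongr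
      _ = _ := by ring
  have hpow : X ^ (3 + ε) = X ^ 3 * (X ^ (ε/2)) ^ 2 := by
    rw [Real.rpow_add hX0, ← Real.rpow_natCast (X ^ (ε/2)), ← Real.rpow_mul hX0.le,
      ← Real.rpow_natCast X 3]
    norm_num
  calc (J 3 2 X : ℝ) ≤ N * ((MCQ.Q N).card : ℝ) := by exact_mod_cast hJ
    _ ≤ N * (2 * ((MCQ.E N).card : ℝ) ^ 2) := by
      gcongr
      exact_mod_cast hQ
    _ ≤ X * (2 * (8 * X * ((2 + 2/ε) * X ^ (ε/2))) ^ 2) := by gcongr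
    _ = _ := by rw [hpow]; ring
end

section
/- One has J_{3,2}(X) = (18/π²)·X³·log X + (3/π²)·( 12γ − 6·ζ′(2)/ζ(2) − 5 )·X³ + O(X^{5/2} log X), where γ is Euler's constant and ζ is the Riemann zeta function. -/
noncomputable def hx (v : ℤ × ℤ) : ℕ := max (max v.1.natAbs v.2.natAbs) (v.1 - v.2).natAbs

noncomputable def bx (N : ℕ) : Finset (ℤ × ℤ) := Finset.Icc (-(N:ℤ)) N ×ˢ Finset.Icc (-(N:ℤ)) N

def hf (v : ℤ × ℤ) : Prop := 0 < v.1 ∨ (v.1 = 0 ∧ v.2 < 0)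

instance : DecidablePred hf := fun v => by unfold hf; infer_instance

theorem mem_half (N m : ℕ) (p s : ℤ) :
    (p, s) ∈ ((bx N).filter hf).filter (fun v => hx v = m) ↔
    ((-(N:ℤ) ≤ p ∧ p ≤ N) ∧ (-(N:ℤ) ≤ s ∧ s ≤ N)) ∧ (0 < p ∨ (p = 0 ∧ s < 0)) ∧
      max (max p.natAbs s.natAbs) (p - s).natAbs = m := by
  rw [Finset.mem_filter, Finset.mem_filter]
  simp only [bx, hf, hx, Finset.mem_product, Finset.mem_Icc, and_assoc]

theorem mem_prim (N m : ℕ) (p s : ℤ) :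
    (p, s) ∈ ((bx N).filter (fun v => IsCoprime v.1 v.2)).filter (fun v => hx v = m) ↔
    ((-(N:ℤ) ≤ p ∧ p ≤ N) ∧ (-(N:ℤ) ≤ s ∧ s ≤ N)) ∧ IsCoprime p s ∧
      max (max p.natAbs s.natAbs) (p - s).natAbs = m := by
  rw [Finset.mem_filter, Finset.mem_filter]
  simp only [bx, hx, Finset.mem_product, Finset.mem_Icc, and_assoc]

theorem card_half (N m : ℕ) (h1 : 1 ≤ m) (h2 : m ≤ N) :
    (((bx N).filter hf).filter (fun v => hx v = m)).card = 3 * m := by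
  have : (Finset.range 3 ×ˢ Finset.range m).card = 3 * m := by simp
  rw [← this]
  symm
  apply Finset.card_nbij'
    (fun jk => if jk.1 = 0 then ((m:ℤ), (jk.2:ℤ)) else if jk.1 = 1 then ((m:ℤ) - jk.2, (m:ℤ))
      else ((jk.2:ℤ), (jk.2:ℤ) - m))
    (fun v => if v.1 = m ∧ 0 ≤ v.2 ∧ v.2 < m then (0, v.2.toNat) else
      if v.2 = m then (1, (m - v.1).toNat) else (2, v.1.toNat))
  · rintro ⟨j, k⟩ h
    simp only [Finset.coe_product, Set.mem_prod, Finset.coe_range, Set.mem_Iio] at h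
    rw [Finset.mem_coe]
    simp only []
    split_ifs <;> rw [mem_half] <;> omega
  · rintro ⟨p, s⟩ h
    rw [Finset.mem_coe, mem_half] at h
    simp only [Finset.coe_product, Set.mem_prod, Finset.coe_range, Set.mem_Iio]
    split_ifs <;> simp only [] <;> omega
  · rintro ⟨j, k⟩ h
    simp only [Finset.coe_product, Set.mem_prod, Finset.coe_range, Set.mem_Iio] at h
    rcases h with ⟨hj, hk⟩
    have : j = 0 ∨ j = 1 ∨ j = 2 := by omega
    rcases this with rfl | rfl | rfl <;> simp <;> (try split_ifs) <;> (try simp only [Prod.mk.injEq]) <;> omega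
  · rintro ⟨p, s⟩ h
    rw [Finset.mem_coe, mem_half] at h
    simp only []
    split_ifs <;> simp at * <;> omega

set_option maxHeartbeats 2000000 in
theorem card_prim (N n : ℕ) (h1 : 1 ≤ n) (h2 : n ≤ N) :
    (((bx N).filter (fun v => IsCoprime v.1 v.2)).filter (fun v => hx v = n)).card = 6 * n.totient := by
  have : (Finset.range 6 ×ˢ (Finset.range n).filter (fun k => n.Coprime k)).card = 6 * n.totient := by
    simp [Nat.totient]
  rw [← this]
  symm
  apply Finset.card_nbij'
    (fun jk => if jk.1 = 0 then ((n:ℤ), (jk.2:ℤ)) else if jk.1 = 1 then ((n:ℤ) - jk.2, (n:ℤ))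
      else if jk.1 = 2 then ((jk.2:ℤ), (jk.2:ℤ) - n)
      else if jk.1 = 3 then (-(n:ℤ), -(jk.2:ℤ)) else if jk.1 = 4 then ((jk.2:ℤ) - n, -(n:ℤ))
      else (-(jk.2:ℤ), (n:ℤ) - jk.2))
    (fun v => if v.1 = n ∧ 0 ≤ v.2 ∧ v.2 < n then (0, v.2.toNat) else
      if v.2 = n ∧ 0 < v.1 then (1, (n - v.1).toNat) else 
      if v.1 = n + v.2 ∧ 0 ≤ v.1 ∧ v.1 < n then (2, v.1.toNat) else
      if v.1 = -n ∧ v.2 ≤ 0 ∧ -n < v.2 then (3, (-v.2).toNat) else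
      if v.2 = -n ∧ v.1 < 0 then (4, (v.1 + n).toNat) else 
       (5, (-v.1).toNat))
  · rintro ⟨j, k⟩ h
    simp only [Finset.coe_product, Set.mem_prod, Finset.coe_range, Set.mem_Iio, Finset.coe_filter, Finset.mem_range, Set.mem_ofPred_eq] at h
    obtain ⟨hj, hk, hc⟩ := h
    have hc := Nat.isCoprime_iff_coprime.2 hc
    rw [Finset.mem_coe]
    simp only []
    have e1 : IsCoprime ((n:ℤ) - k) n := by
      obtain ⟨a, b, h⟩ := hc; exact ⟨-b, a + b, by linear_combination h⟩
    have e2 : IsCoprime (k:ℤ) ((k:ℤ) - n) := by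
      obtain ⟨a, b, h⟩ := hc; exact ⟨a + b, -a, by linear_combination h⟩
    have e3 : IsCoprime (-(n:ℤ)) (-k) := hc.neg_neg
    have e4 : IsCoprime ((k:ℤ) - n) (-n) := by
      obtain ⟨a, b, h⟩ := hc; exact ⟨b, -(a + b), by linear_combination h⟩
    have e5 : IsCoprime (-(k:ℤ)) ((n:ℤ) - k) := by
      obtain ⟨a, b, h⟩ := hc; exact ⟨-(a + b), a, by linear_combination h⟩
    split_ifs <;> rw [mem_prim] <;> simp only [*, true_and] <;> omega
  · rintro ⟨p, s⟩ h
    rw [Finset.mem_coe, mem_prim] at h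
    obtain ⟨hb, ⟨a, b, hc⟩, hn⟩ := h
    simp only [Finset.coe_product, Set.mem_prod, Finset.coe_range, Set.mem_Iio, Finset.coe_filter, Finset.mem_range, Set.mem_ofPred_eq]
    split_ifs with c1 c2 c3 c4 c5 <;> refine ⟨by simp, by simp only []; omega, ?_⟩ <;> simp only [] <;> rw [← Nat.isCoprime_iff_coprime]
    · rw [Int.toNat_of_nonneg (by omega)]; exact ⟨a, b, by rw [← c1.1]; exact hc⟩
    · rw [Int.toNat_of_nonneg (by omega)]; exact ⟨a + b, -a, by rw [← c2.1]; linear_combination hc⟩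
    · rw [Int.toNat_of_nonneg (by omega)]; exact ⟨-b, a+b, by rw [show (n:ℤ) = p - s by omega]; linear_combination hc⟩
    · rw [Int.toNat_of_nonneg (by omega)]; exact ⟨-a, -b, by rw [show (n:ℤ) = -p by omega]; linear_combination hc⟩
    · rw [Int.toNat_of_nonneg (by omega)]; exact ⟨-a-b, a, by rw [show (n:ℤ) = -s by omega]; linear_combination hc⟩
    · rw [Int.toNat_of_nonneg (by omega)]; exact ⟨b, -a-b, by rw [show (n:ℤ) = s - p by omega]; linear_combination hc⟩
  · rintro ⟨j, k⟩ h
    simp only [Finset.coe_product, Set.mem_prod, Finset.coe_range, Set.mem_Iio, Finset.coe_filter, Finset.mem_range, Set.mem_ofPred_eq] at h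
    rcases h with ⟨hj, hk, -⟩
    have : j = 0 ∨ j = 1 ∨ j = 2 ∨ j = 3 ∨ j = 4 ∨ j = 5 := by omega
    rcases this with rfl | rfl | rfl | rfl | rfl | rfl <;> simp only [] <;> norm_num <;> (try split_ifs) <;> (try simp only [Prod.mk.injEq]) <;> omega
  · rintro ⟨p, s⟩ h
    rw [Finset.mem_coe, mem_prim] at h
    obtain ⟨hb, -, hn⟩ := h
    simp only []
    generalize hw : (if p = (n:ℤ) ∧ 0 ≤ s ∧ s < n then (0, s.toNat) else
      if s = n ∧ 0 < p then (1, (n - p).toNat) else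
      if p = n + s ∧ 0 ≤ p ∧ p < n then (2, p.toNat) else
      if p = -n ∧ s ≤ 0 ∧ -n < s then (3, (-s).toNat) else
      if s = -n ∧ p < 0 then (4, (p + n).toNat) else
       (5, (-p).toNat) : ℕ × ℕ) = w
    split_ifs at hw <;> subst hw <;> norm_num <;> omega

theorem det_le (p s q r m n : ℤ) (h1 : |p| ≤ m) (h2 : |s| ≤ m) (h3 : |p - s| ≤ m)
    (h4 : |q| ≤ n) (h5 : |r| ≤ n) (h6 : |q - r| ≤ n) : q * s - p * r ≤ m * n := by
  rw [abs_le] at *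
  have hm : 0 ≤ m := by omega
  rcases le_total 0 q with hq | hq <;> rcases le_total 0 r with hr | hr <;>
    rcases le_total q r with hqr | hqr <;> nlinarith

theorem abs_hx (v : ℤ × ℤ) : |v.1| ≤ hx v ∧ |v.2| ≤ hx v ∧ |v.1 - v.2| ≤ hx v := by
  simp only [hx, Int.abs_eq_natAbs]; omega

theorem mul_hx (a b m n : ℤ) (h : |a| ≤ m) (h' : |b| ≤ n) : a * b ≤ m * n := by
  calc a * b ≤ |a * b| := le_abs_self _
    _ = |a| * |b| := abs_mul _ _
    _ ≤ m * n := mul_le_mul h h' (abs_nonneg _) ((abs_nonneg _).trans h)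

set_option maxHeartbeats 2000000 in
theorem card_t (N : ℕ) (p s q r : ℤ) :
    ((Finset.Icc (1:ℤ) N).filter (fun t => 
      (1 ≤ t - p * q ∧ t - p * q ≤ N) ∧ (1 ≤ t - r * s ∧ t - r * s ≤ N) ∧
      (1 ≤ t + p * r + q * s - p * q - r * s ∧ t + p * r + q * s - p * q - r * s ≤ N) ∧
      (1 ≤ t + q * s - p * q - r * s ∧ t + q * s - p * q - r * s ≤ N) ∧
      (1 ≤ t + p * r - p * q - r * s ∧ t + p * r - p * q - r * s ≤ N))).card =
    N - hx (p, s) * hx (q, r) := by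
  obtain ⟨a1, a2, a3⟩ := abs_hx (p, s)
  obtain ⟨b1, b2, b3⟩ := abs_hx (q, r)
  have attP : |p| = hx (p, s) ∨ |s| = hx (p, s) ∨ |p - s| = hx (p, s) := by
    simp only [hx, Int.abs_eq_natAbs]; omega
  have attQ : |q| = hx (q, r) ∨ |r| = hx (q, r) ∨ |q - r| = hx (q, r) := by
    simp only [hx, Int.abs_eq_natAbs]; omega
  simp only [] at a1 a2 a3 b1 b2 b3
  set m := hx (p, s)
  set n := hx (q, r)
  have a1' : |-p| ≤ m := by rwa [abs_neg]
  have a2' : |-s| ≤ m := by rwa [abs_neg]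
  have a3' : |s - p| ≤ m := by rwa [abs_sub_comm]
  have b1' : |-q| ≤ n := by rwa [abs_neg]
  have b2' : |-r| ≤ n := by rwa [abs_neg]
  have b3' : |r - q| ≤ n := by rwa [abs_sub_comm]
  have u1 := mul_hx _ _ _ _ a1 b1
  have u2 := mul_hx _ _ _ _ a1 b2
  have u3 := mul_hx _ _ _ _ a1 b3
  have u4 := mul_hx _ _ _ _ a2 b1
  have u5 := mul_hx _ _ _ _ a2 b2
  have u6 := mul_hx _ _ _ _ a2 b3
  have u7 := mul_hx _ _ _ _ a3 b1
  have u8 := mul_hx _ _ _ _ a3 b2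
  have u9 := mul_hx _ _ _ _ a3 b3
  have w1 := mul_hx _ _ _ _ a1' b1
  have w2 := mul_hx _ _ _ _ a1' b2
  have w3 := mul_hx _ _ _ _ a1' b3
  have w4 := mul_hx _ _ _ _ a2' b1
  have w5 := mul_hx _ _ _ _ a2' b2
  have w6 := mul_hx _ _ _ _ a2' b3
  have w7 := mul_hx _ _ _ _ a3' b1
  have w8 := mul_hx _ _ _ _ a3' b2
  have w9 := mul_hx _ _ _ _ a3' b3
  -- determinants
  have d1 := det_le p s q r m n a1 a2 a3 b1 b2 b3
  have d1' := det_le p s (-q) (-r) m n a1 a2 a3 b1' b2' (by convert b3' using 2; ring)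
  have d2 := det_le s (s - p) q r m n a2 a3' (by convert a1 using 2; ring) b1 b2 b3
  have d2' := det_le s (s - p) (-q) (-r) m n a2 a3' (by convert a1 using 2; ring) b1' b2' (by convert b3' using 2; ring)
  have d3 := det_le (p - s) p q r m n a3 a1 (by convert a2' using 2; ring) b1 b2 b3
  have d3' := det_le (p - s) p (-q) (-r) m n a3 a1 (by convert a2' using 2; ring) b1' b2' (by convert b3' using 2; ring)
  have c1 := det_le s p q r m n a2 a1 a3' b1 b2 b3
  have c1' := det_le s p (-q) (-r) m n a2 a1 a3' b1' b2' (by convert b3' using 2; ring)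
  have c2 := det_le (s - p) s q r m n a3' a2 (by convert a1' using 2; ring) b1 b2 b3
  have c2' := det_le (s - p) s (-q) (-r) m n a3' a2 (by convert a1' using 2; ring) b1' b2' (by convert b3' using 2; ring)
  have c3 := det_le p (p - s) q r m n a1 a3 (by convert a2 using 2; ring) b1 b2 b3
  have c3' := det_le p (p - s) (-q) (-r) m n a1 a3 (by convert a2 using 2; ring) b1' b2' (by convert b3' using 2; ring)
  have att : ∃ z : ℤ, |z| = (m:ℤ) * n ∧ (z = p * q ∨ z = p * r ∨ z = p * q - p * r ∨ z = q * s ∨ z = r * s ∨ z = q * s - r * s ∨ z = p * q - q * s ∨ z = p * r - r * s ∨ z = p * q - p * r - q * s + r * s) := by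
    rcases attP with h | h | h <;> rcases attQ with h' | h' | h' <;> 
      rw [← h, ← h', ← abs_mul] <;> refine ⟨_, rfl, ?_⟩ <;> ring_nf <;> simp 
  have hR : ((m * n : ℕ) : ℤ) = (m:ℤ) * n := by push_cast; rfl
  clear_value m n
  have exlo : ∃ lo : ℤ, (lo ≤ 0 ∧ lo ≤ -(p * q) ∧ lo ≤ -(r * s) ∧ lo ≤ p * r + q * s - p * q - r * s ∧
     lo ≤ q * s - p * q - r * s ∧ lo ≤ p * r - p * q - r * s) ∧
     (lo = 0 ∨ lo = -(p * q) ∨ lo = -(r * s) ∨ lo = p * r + q * s - p * q - r * s ∨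
     lo = q * s - p * q - r * s ∨ lo = p * r - p * q - r * s) :=
    ⟨min 0 (min (-(p * q)) (min (-(r * s)) (min (p * r + q * s - p * q - r * s) 
      (min (q * s - p * q - r * s) (p * r - p * q - r * s))))), by omega, by omega⟩
  have exhi : ∃ lo : ℤ, (0 ≤ lo ∧ -(p * q) ≤ lo ∧ -(r * s) ≤ lo ∧ p * r + q * s - p * q - r * s ≤ lo ∧
     q * s - p * q - r * s ≤ lo ∧ p * r - p * q - r * s ≤ lo) ∧
     (lo = 0 ∨ lo = -(p * q) ∨ lo = -(r * s) ∨ lo = p * r + q * s - p * q - r * s ∨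
     lo = q * s - p * q - r * s ∨ lo = p * r - p * q - r * s) :=
    ⟨max 0 (max (-(p * q)) (max (-(r * s)) (max (p * r + q * s - p * q - r * s) 
      (max (q * s - p * q - r * s) (p * r - p * q - r * s))))), by omega, by omega⟩
  obtain ⟨lo, ⟨l1, l2, l3, l4, l5, l6⟩, hlo⟩ := exlo
  obtain ⟨hi, ⟨k1, k2, k3, k4, k5, k6⟩, hhi⟩ := exhi
  have hRR : hi - lo = (m:ℤ) * n := by
    apply le_antisymm
    · have hmn : (0:ℤ) ≤ m * n := by positivity
      rcases hlo with h | h | h | h | h | h <;> rcases hhi with h' | h' | h' | h' | h' | h' <;>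
        rw [h, h'] <;> linarith
    · obtain ⟨z, hz, hz'⟩ := att
      rw [← hz, abs_le']
      rcases hz' with h | h | h | h | h | h | h | h | h <;> rw [h] <;> constructor <;> linarith
  have : (Finset.Icc (1:ℤ) N).filter (fun t => 
      (1 ≤ t - p * q ∧ t - p * q ≤ N) ∧ (1 ≤ t - r * s ∧ t - r * s ≤ N) ∧
      (1 ≤ t + p * r + q * s - p * q - r * s ∧ t + p * r + q * s - p * q - r * s ≤ N) ∧
      (1 ≤ t + q * s - p * q - r * s ∧ t + q * s - p * q - r * s ≤ N) ∧
      (1 ≤ t + p * r - p * q - r * s ∧ t + p * r - p * q - r * s ≤ N)) = Finset.Icc (1 - lo) (N - hi) := by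
    ext t
    simp only [Finset.mem_filter, Finset.mem_Icc]
    constructor
    · rintro ⟨h1, h2, h3, h4, h5, h6⟩
      constructor
      · rcases hlo with h | h | h | h | h | h <;> linarith
      · rcases hhi with h | h | h | h | h | h <;> linarith
    · rintro ⟨h1, h2⟩
      refine ⟨⟨?_, ?_⟩, ⟨?_, ?_⟩, ⟨?_, ?_⟩, ⟨?_, ?_⟩, ⟨?_, ?_⟩, ⟨?_, ?_⟩⟩ <;> linarith
  rw [this, Int.card_Icc]
  rw [← hRR] at hR
  generalize m * n = R' at *
  omega

theorem bb_inj {p s q r p' s' q' r' : ℤ} (h : hf (p, s)) (h' : hf (p', s'))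
    (hc : IsCoprime q r) (hc' : IsCoprime q' r') (ea : p * q = p' * q') (eb : r * s = r' * s')
    (ec : p * r = p' * r') (ed : q * s = q' * s') : p = p' ∧ s = s' ∧ q = q' ∧ r = r' := by
  obtain ⟨a, b, hab⟩ := hc
  obtain ⟨a', b', hab'⟩ := hc'
  have e1 : p' ∣ p := ⟨a * q' + b * r', by linear_combination a * ea + b * ec - p * hab⟩
  have e2 : p ∣ p' := ⟨a' * q + b' * r, by linear_combination (-a') * ea - b' * ec - p' * hab'⟩
  have e3 : s' ∣ s := ⟨a * q' + b * r', by linear_combination a * ed + b * eb - s * hab⟩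
  have e4 : s ∣ s' := ⟨a' * q + b' * r, by linear_combination (-a') * ed - b' * eb - s' * hab'⟩
  simp only [hf] at h h'
  rcases h with h | ⟨h, hs⟩ <;> rcases h' with h' | ⟨h', hs'⟩
  · have hp : p = p' := Int.dvd_antisymm h.le h'.le e2 e1
    subst hp
    have hq := mul_left_cancel₀ h.ne' ea
    have hr := mul_left_cancel₀ h.ne' ec
    subst hq hr
    exact ⟨rfl, by linear_combination a * ed + b * eb - (s - s') * hab, rfl, rfl⟩
  · rw [h'] at e1; have := zero_dvd_iff.1 e1; omega
  · rw [h] at e2; have := zero_dvd_iff.1 e2; omega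
  · have hp : -s = -s' := Int.dvd_antisymm (by omega) (by omega) (by simpa using e4) (by simpa using e3)
    have hp : s = s' := by omega
    subst hp
    have hq := mul_right_cancel₀ hs.ne ed
    have hr := mul_right_cancel₀ hs.ne eb
    subst hq hr
    exact ⟨by omega, rfl, rfl, rfl⟩

theorem bb_surj {a b c d : ℤ} (h : a * b = c * d) (h0 : ¬ (a = 0 ∧ b = 0 ∧ c = 0 ∧ d = 0)) :
    ∃ p s q r : ℤ, hf (p, s) ∧ IsCoprime q r ∧ a = p * q ∧ b = r * s ∧ c = p * r ∧ d = q * s := by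
  by_cases hac : a = 0 ∧ c = 0
  · obtain ⟨rfl, rfl⟩ := hac
    have hg : 0 < Int.gcd d b := by
      rw [Int.gcd_pos_iff]; by_contra hh; push Not at hh; exact h0 ⟨rfl, hh.2, rfl, hh.1⟩
    obtain ⟨q, r, hqr, e1, e2⟩ := Int.exists_gcd_one hg
    refine ⟨0, -(Int.gcd d b : ℤ), -q, -r, Or.inr ⟨rfl, ?_⟩, ?_, by ring, ?_, by ring, ?_⟩
    · simp only []; omega
    · exact (Int.isCoprime_iff_gcd_eq_one.2 hqr).neg_neg
    · rw [neg_mul_neg]; exact e2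
    · rw [neg_mul_neg]; exact e1
  · have hg : 0 < Int.gcd a c := by
      rw [Int.gcd_pos_iff]; by_contra hh; push Not at hh; exact hac hh
    obtain ⟨q, r, hqr, e1, e2⟩ := Int.exists_gcd_one hg
    generalize Int.gcd a c = g at *
    have hcop := Int.isCoprime_iff_gcd_eq_one.2 hqr
    obtain ⟨u, v, huv⟩ := hcop
    have hqb : q * b = r * d := by
      have : (g:ℤ) ≠ 0 := by omega
      apply mul_left_cancel₀ this
      rw [e1, e2] at h
      linear_combination h
    refine ⟨g, u * d + v * b, q, r, Or.inl (by simp only []; omega), ⟨u, v, huv⟩, by rw [e1]; ring, ?_, by rw [e2]; ring, ?_⟩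
    · linear_combination -b * huv + u * hqb
    · linear_combination -d * huv - v * hqb

noncomputable def tset (N : ℕ) (v : (ℤ × ℤ) × (ℤ × ℤ)) : Finset ℤ :=
  (Finset.Icc (1:ℤ) N).filter (fun t => 
      (1 ≤ t - v.1.1 * v.2.1 ∧ t - v.1.1 * v.2.1 ≤ N) ∧ (1 ≤ t - v.2.2 * v.1.2 ∧ t - v.2.2 * v.1.2 ≤ N) ∧
      (1 ≤ t + v.1.1 * v.2.2 + v.2.1 * v.1.2 - v.1.1 * v.2.1 - v.2.2 * v.1.2 ∧ t + v.1.1 * v.2.2 + v.2.1 * v.1.2 - v.1.1 * v.2.1 - v.2.2 * v.1.2 ≤ N) ∧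
      (1 ≤ t + v.2.1 * v.1.2 - v.1.1 * v.2.1 - v.2.2 * v.1.2 ∧ t + v.2.1 * v.1.2 - v.1.1 * v.2.1 - v.2.2 * v.1.2 ≤ N) ∧
      (1 ≤ t + v.1.1 * v.2.2 - v.1.1 * v.2.1 - v.2.2 * v.1.2 ∧ t + v.1.1 * v.2.2 - v.1.1 * v.2.1 - v.2.2 * v.1.2 ≤ N))

theorem card_tset (N : ℕ) (v : (ℤ × ℤ) × (ℤ × ℤ)) : (tset N v).card = N - hx v.1 * hx v.2 :=
  card_t N v.1.1 v.1.2 v.2.1 v.2.2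

noncomputable def Tall (N : ℕ) : Finset (Σ _ : (ℤ × ℤ) × (ℤ × ℤ), ℤ) :=
  (((bx N).filter hf) ×ˢ ((bx N).filter (fun v => IsCoprime v.1 v.2))).sigma (tset N)

def fmap (z : Σ _ : (ℤ × ℤ) × (ℤ × ℤ), ℤ) : (Fin 3 → ℤ) × (Fin 3 → ℤ) :=
  (![z.2 + z.1.2.1 * z.1.1.2 - z.1.1.1 * z.1.2.1 - z.1.2.2 * z.1.1.2,
     z.2 + z.1.1.1 * z.1.2.2 - z.1.1.1 * z.1.2.1 - z.1.2.2 * z.1.1.2, z.2],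
   ![z.2 - z.1.1.1 * z.1.2.1, z.2 - z.1.2.2 * z.1.1.2,
     z.2 + z.1.1.1 * z.1.2.2 + z.1.2.1 * z.1.1.2 - z.1.1.1 * z.1.2.1 - z.1.2.2 * z.1.1.2])

theorem hx_pos_half {v : ℤ × ℤ} (h : hf v) : 1 ≤ hx v := by
  simp only [hf, hx] at *; omega

theorem hx_pos_prim {v : ℤ × ℤ} (h : IsCoprime v.1 v.2) : 1 ≤ hx v := by
  by_contra hh
  simp only [hx] at hh
  have h1 : v.1 = 0 := by omega
  have h2 : v.2 = 0 := by omega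
  rw [h1, h2] at h
  exact not_isCoprime_zero_zero h

theorem mem_bx (N : ℕ) (v : ℤ × ℤ) (h : hx v ≤ N) : v ∈ bx N := by
  simp only [bx, hx, Finset.mem_product, Finset.mem_Icc] at *; omega

theorem card_Tall (N : ℕ) : (Tall N).card =
    ∑ m ∈ Finset.Icc 1 N, ∑ n ∈ Finset.Icc 1 N, 18 * m * n.totient * (N - m * n) := by
  rw [Tall, Finset.card_sigma]
  simp only [card_tset]
  rw [Finset.sum_product]
  simp only []
  have hin : ∀ k : ℕ, ∑ y ∈ (bx N).filter (fun v => IsCoprime v.1 v.2), (N - k * hx y) =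
      if k = 0 then ∑ y ∈ (bx N).filter (fun v => IsCoprime v.1 v.2), N else
      ∑ n ∈ Finset.Icc 1 N, 6 * n.totient * (N - k * n) := by
    intro k
    split_ifs with hk
    · simp [hk]
    have : ∑ y ∈ (bx N).filter (fun v => IsCoprime v.1 v.2), (N - k * hx y) = 
        ∑ y ∈ ((bx N).filter (fun v => IsCoprime v.1 v.2)).filter (fun v => hx v ≤ N), (N - k * hx y) := by
      symm
      apply Finset.sum_filter_of_ne
      intro x _ hx0
      have : k * hx x < N := by omega
      have : 1 * hx x ≤ k * hx x := Nat.mul_le_mul_right _ (by omega)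
      omega
    rw [this, ← Finset.sum_fiberwise_of_maps_to (t := Finset.Icc 1 N) (g := hx)]
    · apply Finset.sum_congr rfl
      intro n hn
      rw [Finset.mem_Icc] at hn
      rw [Finset.sum_congr rfl (g := fun _ => N - k * n)]
      · rw [Finset.sum_const, smul_eq_mul]
        congr 1
        rw [← card_prim N n hn.1 hn.2]
        congr 1
        ext v
        simp only [Finset.mem_filter]
        constructor
        · rintro ⟨⟨a, b⟩, c⟩; exact ⟨a, c⟩
        · rintro ⟨a, c⟩; exact ⟨⟨a, c ▸ hn.2⟩, c⟩
      · intro x hxx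
        rw [Finset.mem_filter] at hxx
        rw [hxx.2]
    · intro v hv
      simp only [Finset.mem_filter] at hv
      exact Finset.mem_Icc.2 ⟨hx_pos_prim hv.1.2, hv.2⟩
  have : ∑ x ∈ (bx N).filter hf, ∑ y ∈ (bx N).filter (fun v => IsCoprime v.1 v.2), (N - hx x * hx y) =
      ∑ x ∈ ((bx N).filter hf).filter (fun v => hx v ≤ N), ∑ n ∈ Finset.Icc 1 N, 6 * n.totient * (N - hx x * n) := by
    rw [Finset.sum_filter (fun v => hx v ≤ N)]
    apply Finset.sum_congr rfl
    intro x hxx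
    have h1 := hx_pos_half (Finset.mem_filter.1 hxx).2
    rw [hin, if_neg (by omega)]
    split_ifs with h
    · rfl
    · apply Finset.sum_eq_zero
      intro n hn
      rw [Finset.mem_Icc] at hn
      have : hx x * 1 ≤ hx x * n := Nat.mul_le_mul_left _ hn.1
      rw [Nat.sub_eq_zero_of_le (by omega), mul_zero]
  rw [this, ← Finset.sum_fiberwise_of_maps_to (t := Finset.Icc 1 N) (g := hx)]
  · apply Finset.sum_congr rfl
    intro m hm
    rw [Finset.mem_Icc] at hm
    rw [Finset.sum_congr rfl (g := fun _ => ∑ n ∈ Finset.Icc 1 N, 6 * n.totient * (N - m * n))]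
    · have hc : ((((bx N).filter hf).filter (fun v => hx v ≤ N)).filter (fun v => hx v = m)).card = 3 * m := by
        rw [← card_half N m hm.1 hm.2]
        congr 1
        ext v
        simp only [Finset.mem_filter]
        constructor
        · rintro ⟨⟨a, b⟩, c⟩; exact ⟨a, c⟩
        · rintro ⟨a, c⟩; exact ⟨⟨a, c ▸ hm.2⟩, c⟩
      rw [Finset.sum_const, smul_eq_mul, hc, Finset.mul_sum]
      apply Finset.sum_congr rfl
      intro n _
      ring
    · intro x hxx
      rw [Finset.mem_filter] at hxx
      rw [hxx.2]
  · intro v hv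
    simp only [Finset.mem_filter] at hv
    exact Finset.mem_Icc.2 ⟨hx_pos_half hv.1.2, hv.2⟩

theorem fmap_inj (N : ℕ) : Set.InjOn fmap (Tall N : Set _) := by
  rintro ⟨⟨⟨p, s⟩, ⟨q, r⟩⟩, t⟩ h ⟨⟨⟨p', s'⟩, ⟨q', r'⟩⟩, t'⟩ h' e
  rw [Finset.mem_coe, Tall, Finset.mem_sigma, Finset.mem_product, Finset.mem_filter, Finset.mem_filter] at h h'
  obtain ⟨⟨⟨-, h1⟩, ⟨-, h2⟩⟩, -⟩ := h
  obtain ⟨⟨⟨-, h1'⟩, ⟨-, h2'⟩⟩, -⟩ := h'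
  simp only [fmap, Prod.mk.injEq] at e
  obtain ⟨e1, e2⟩ := e
  have a0 := congrFun e1 0
  have a1 := congrFun e1 1
  have a2 := congrFun e1 2
  have b0 := congrFun e2 0
  have b1 := congrFun e2 1
  have b2 := congrFun e2 2
  simp at a0 a1 a2 b0 b1 b2
  obtain ⟨rfl, rfl, rfl, rfl⟩ := bb_inj h1 h1' h2 h2' (by linarith) (by linarith) (by linarith) (by linarith)
  rw [a2]

theorem J_eq (X : ℝ) (hX : 1 ≤ X) : J 3 2 X = ⌊X⌋₊ +
    ∑ m ∈ Finset.Icc 1 ⌊X⌋₊, ∑ n ∈ Finset.Icc 1 ⌊X⌋₊, 18 * m * n.totient * (⌊X⌋₊ - m * n) := by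
  set N := ⌊X⌋₊ with hN
  have hfl : ∀ z : ℤ, 1 ≤ z → ((z:ℝ) ≤ X ↔ z ≤ N) := by
    intro z hz
    lift z to ℕ using (by omega)
    rw [hN]
    have := Nat.le_floor_iff (a := X) (n := z) (by linarith)
    norm_cast
    rw [this]
  rw [← card_Tall N]
  classical
  let triv : Finset ((Fin 3 → ℤ) × (Fin 3 → ℤ)) := (Finset.Icc (1:ℤ) N).image (fun t => (fun _ => t, fun _ => t))
  have hct : triv.card = N := by
    rw [Finset.card_image_of_injective, Int.card_Icc]
    · omega
    · intro a b h
      exact congrFun (Prod.mk.inj h).1 0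
  have hci : ((Tall N).image fmap).card = (Tall N).card := Finset.card_image_of_injOn (fmap_inj N)
  have hdisj : Disjoint triv ((Tall N).image fmap) := by
    rw [Finset.disjoint_left]
    intro z hz hz'
    obtain ⟨t, -, rfl⟩ := Finset.mem_image.1 hz
    obtain ⟨⟨⟨⟨p, s⟩, ⟨q, r⟩⟩, t'⟩, h, e⟩ := Finset.mem_image.1 hz'
    rw [Tall, Finset.mem_sigma, Finset.mem_product, Finset.mem_filter, Finset.mem_filter] at h
    obtain ⟨⟨⟨-, h1⟩, ⟨-, h2⟩⟩, -⟩ := h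
    simp only [fmap, Prod.mk.injEq] at e
    obtain ⟨e1, e2⟩ := e
    have a0 := congrFun e1 0
    have a1 := congrFun e1 1
    have a2 := congrFun e1 2
    have b0 := congrFun e2 0
    have b1 := congrFun e2 1
    have b2 := congrFun e2 2
    simp at a0 a1 a2 b0 b1 b2 h1 h2
    obtain ⟨u, v, huv⟩ := h2
    have hp : p = 0 := by
      have h1 : p * q = 0 := by linarith
      have h2 : p * r = 0 := by linarith
      linear_combination u * h1 + v * h2 - p * huv
    have hs : s = 0 := by
      have h1 : q * s = 0 := by linarith
      have h2 : r * s = 0 := by linarith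
      linear_combination u * h1 + v * h2 - s * huv
    simp [hf, hp, hs] at h1
  have htot : N + (Tall N).card = (triv ∪ (Tall N).image fmap).card := by
    rw [Finset.card_union_of_disjoint hdisj, hct, hci]
  rw [htot, J, ← Set.ncard_coe_finset]
  congr 1
  ext ⟨x, y⟩
  rw [Finset.mem_coe, Finset.mem_union]
  have hsum : (∀ j ∈ Finset.Icc 1 2, ∑ i, x i ^ j = ∑ i, y i ^ j) ↔
     (x 0 + x 1 + x 2 = y 0 + y 1 + y 2 ∧ x 0 ^ 2 + x 1 ^ 2 + x 2 ^ 2 = y 0 ^ 2 + y 1 ^ 2 + y 2 ^ 2) := by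
    rw [show Finset.Icc 1 2 = {1, 2} from rfl]
    simp [Fin.sum_univ_three]
  have hbd : ∀ w : Fin 3 → ℤ, (∀ i, 1 ≤ w i ∧ (w i : ℝ) ≤ X) ↔ (∀ i, 1 ≤ w i ∧ w i ≤ N) := by
    intro w
    exact forall_congr' fun i => and_congr_right fun h => hfl _ h
  change ((∀ i, 1 ≤ x i ∧ (x i : ℝ) ≤ X) ∧ (∀ i, 1 ≤ y i ∧ (y i : ℝ) ≤ X) ∧
    ∀ j ∈ Finset.Icc 1 2, ∑ i, x i ^ j = ∑ i, y i ^ j) ↔ _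
  have h3 : ∀ P : Fin 3 → Prop, (∀ i, P i) ↔ (P 0 ∧ P 1 ∧ P 2) := fun P =>
    ⟨fun h => ⟨h 0, h 1, h 2⟩, fun ⟨a, b, c⟩ i => by fin_cases i <;> assumption⟩
  rw [hsum, hbd, hbd, h3, h3 (fun i => 1 ≤ y i ∧ y i ≤ N)]
  constructor
  · rintro ⟨⟨⟨x0, x0'⟩, ⟨x1, x1'⟩, ⟨x2, x2'⟩⟩, ⟨⟨y0, y0'⟩, ⟨y1, y1'⟩, ⟨y2, y2'⟩⟩, h1, h2⟩
    by_cases h0 : x 2 - y 0 = 0 ∧ x 2 - y 1 = 0 ∧ y 2 - x 0 = 0 ∧ y 2 - x 1 = 0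
    · left
      refine Finset.mem_image.2 ⟨x 2, Finset.mem_Icc.2 ⟨x2, x2'⟩, ?_⟩
      rw [Prod.mk.injEq]
      constructor <;> ext i <;> fin_cases i <;> simp <;> omega
    · right
      have hab : (x 2 - y 0) * (x 2 - y 1) = (y 2 - x 0) * (y 2 - x 1) := by
        have h3 : x 2 = y 0 + y 1 + y 2 - x 0 - x 1 := by linarith
        rw [h3] at h2 ⊢
        linarith
      obtain ⟨p, s, q, r, hh, hc, e1, e2, e3, e4⟩ := bb_surj hab h0
      refine Finset.mem_image.2 ⟨⟨((p, s), (q, r)), x 2⟩, ?_, ?_⟩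
      · have ht : x 2 ∈ tset N ((p, s), (q, r)) := by
          simp only [tset, Finset.mem_filter, Finset.mem_Icc]
          refine ⟨⟨?_, ?_⟩, ⟨?_, ?_⟩, ⟨?_, ?_⟩, ⟨?_, ?_⟩, ⟨?_, ?_⟩, ⟨?_, ?_⟩⟩ <;> linarith
        have hcard := Finset.card_pos.2 ⟨_, ht⟩
        rw [card_tset] at hcard
        simp only [] at hcard
        have k1 := hx_pos_half hh
        have k2 := hx_pos_prim (v := (q, r)) hc
        have k3 : hx (p, s) * 1 ≤ hx (p, s) * hx (q, r) := Nat.mul_le_mul_left _ k2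
        have k4 : 1 * hx (q, r) ≤ hx (p, s) * hx (q, r) := Nat.mul_le_mul_right _ k1
        rw [Tall, Finset.mem_sigma, Finset.mem_product, Finset.mem_filter, Finset.mem_filter]
        exact ⟨⟨⟨mem_bx _ _ (by simp only []; omega), hh⟩, ⟨mem_bx _ _ (by simp only []; omega), hc⟩⟩, ht⟩
      · simp only [fmap]
        rw [Prod.mk.injEq]
        constructor <;> ext i <;> fin_cases i <;> simp <;> linarith
  · rintro (h | h)
    · obtain ⟨t, ht, e⟩ := Finset.mem_image.1 h
      rw [Finset.mem_Icc] at ht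
      rw [Prod.mk.injEq] at e
      obtain ⟨rfl, rfl⟩ := e
      exact ⟨⟨ht, ht, ht⟩, ⟨ht, ht, ht⟩, rfl, rfl⟩
    · obtain ⟨⟨⟨⟨p, s⟩, ⟨q, r⟩⟩, t⟩, h, e⟩ := Finset.mem_image.1 h
      rw [Tall, Finset.mem_sigma] at h
      have ht := h.2
      simp only [tset, Finset.mem_filter, Finset.mem_Icc] at ht
      obtain ⟨c1, c2, c3, c4, c5, c6⟩ := ht
      rw [fmap, Prod.mk.injEq] at e
      obtain ⟨rfl, rfl⟩ := e
      refine ⟨⟨c5, c6, c1⟩, ⟨c2, c3, c4⟩, ?_, ?_⟩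
      · simp; ring
      · simp; ring

theorem bb_split (M n : ℕ) (h : n ≤ M) (f : ℕ → ℝ) :
    ∑ a ∈ Finset.Icc 1 M, f a = ∑ a ∈ Finset.Icc 1 n, f a + ∑ a ∈ Finset.Icc (n+1) M, f a := by
  rw [← Finset.sum_union]
  · congr 1; ext a; simp only [Finset.mem_union, Finset.mem_Icc]; omega
  · rw [Finset.disjoint_left]; intro a; simp only [Finset.mem_Icc]; omega

theorem bb_sum1 (k : ℕ) : ∑ b ∈ Finset.Icc 1 k, (b:ℝ) = k * (k + 1) / 2 := by
  induction k with
  | zero => simp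
  | succ k ih => rw [Finset.sum_Icc_succ_top (by omega), ih]; push_cast; ring

theorem bb_sum2 (k : ℕ) : ∑ b ∈ Finset.Icc 1 k, (b:ℝ) ^ 2 = k * (k + 1) * (2 * k + 1) / 6 := by
  induction k with
  | zero => simp
  | succ k ih => rw [Finset.sum_Icc_succ_top (by omega), ih]; push_cast; ring

theorem bb_inner (M : ℕ) (z : ℝ) (hz : 1 ≤ z) (hM : z ≤ M) :
    |∑ b ∈ Finset.Icc 1 M, (b:ℝ) * max (z - b) 0 - z ^ 3 / 6| ≤ z := by
  have h1 := Nat.floor_le (show 0 ≤ z by linarith)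
  have h2 := Nat.lt_floor_add_one z
  set k := ⌊z⌋₊
  have hkM : k ≤ M := by
    have : (k:ℝ) ≤ M := h1.trans hM
    exact_mod_cast this
  rw [bb_split M k hkM]
  have e2 : ∑ b ∈ Finset.Icc (k+1) M, (b:ℝ) * max (z - b) 0 = 0 := by
    apply Finset.sum_eq_zero
    intro b hb
    rw [Finset.mem_Icc] at hb
    have : ((k:ℝ) + 1) ≤ b := by exact_mod_cast hb.1
    rw [max_eq_right (by linarith), mul_zero]
  have e1 : ∑ b ∈ Finset.Icc 1 k, (b:ℝ) * max (z - b) 0 = z * (k * (k + 1) / 2) - k * (k + 1) * (2 * k + 1) / 6 := by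
    rw [← bb_sum1, ← bb_sum2, Finset.mul_sum, ← Finset.sum_sub_distrib]
    apply Finset.sum_congr rfl
    intro b hb
    rw [Finset.mem_Icc] at hb
    have : (b:ℝ) ≤ k := by exact_mod_cast hb.2
    rw [max_eq_left (by linarith)]
    ring
  rw [e1, e2, add_zero]
  generalize (k:ℝ) = κ at *
  obtain ⟨θ, rfl⟩ : ∃ θ, κ = z - θ := ⟨z - κ, by ring⟩
  have t0 : 0 ≤ θ := by linarith
  have t1 : θ ≤ 1 := by linarith
  have : z * ((z - θ) * (z - θ + 1) / 2) - (z - θ) * (z - θ + 1) * (2 * (z - θ) + 1) / 6 - z ^ 3 / 6 =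
    (- (1 - 2 * θ) ^ 2 * z - θ * (1 - θ) * z + θ * (1 - θ) * (1 - 2 * θ)) / 6 := by ring
  rw [this, abs_le]
  have q0 : 0 ≤ θ * (1 - θ) := mul_nonneg t0 (by linarith)
  have q1 : θ * (1 - θ) ≤ 1 := by nlinarith
  have q2 : (1 - 2 * θ) ^ 2 ≤ 1 := by nlinarith
  have q3 : 0 ≤ (1 - 2 * θ) ^ 2 := sq_nonneg _
  have q4 : θ * (1 - θ) * (1 - 2 * θ) ≤ 1 := by nlinarith
  have q5 : -1 ≤ θ * (1 - θ) * (1 - 2 * θ) := by nlinarith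
  have q6 : (1 - 2 * θ) ^ 2 * z ≤ 1 * z := mul_le_mul_of_nonneg_right q2 (by linarith)
  have q7 : θ * (1 - θ) * z ≤ 1 * z := mul_le_mul_of_nonneg_right q1 (by linarith)
  have q8 : 0 ≤ (1 - 2 * θ) ^ 2 * z := by positivity
  have q9 : 0 ≤ θ * (1 - θ) * z := mul_nonneg q0 (by linarith)
  constructor <;> linarith

theorem bb_harm (w : ℝ) (n : ℕ) (hn : 1 ≤ n) (h1 : n ≤ w) (h2 : w ≤ n + 1) :
    |∑ a ∈ Finset.Icc 1 n, 1 / (a:ℝ) - (Real.log w + Real.eulerMascheroniConstant)| ≤ 2 / w := by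
  have hH : ∑ a ∈ Finset.Icc 1 n, 1 / (a:ℝ) = (harmonic n : ℝ) := by
    rw [harmonic_eq_sum_Icc]; push_cast; simp
  have a1 := Real.eulerMascheroniSeq_lt_eulerMascheroniConstant n
  have a2 := Real.eulerMascheroniConstant_lt_eulerMascheroniSeq' n
  rw [Real.eulerMascheroniSeq] at a1
  rw [Real.eulerMascheroniSeq', if_neg (by omega)] at a2
  have hn' : (1:ℝ) ≤ n := by exact_mod_cast hn
  have l1 : Real.log n ≤ Real.log w := Real.log_le_log (by linarith) h1
  have l2 : Real.log w ≤ Real.log (n + 1) := Real.log_le_log (by linarith) h2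
  have l3 : Real.log (n + 1) - Real.log n ≤ 2 / w := by
    rw [← Real.log_div (by linarith) (by linarith)]
    have := Real.log_le_sub_one_of_pos (show 0 < ((n:ℝ) + 1) / n by positivity)
    have e : ((n:ℝ) + 1) / n - 1 = 1 / n := by field_simp; ring
    have : 1 / (n:ℝ) ≤ 2 / w := by
      rw [div_le_div_iff₀ (by linarith) (by linarith)]; linarith
    linarith
  rw [hH, abs_le]
  constructor <;> linarith

noncomputable def FM (M : ℕ) (y : ℝ) : ℝ :=
  ∑ a ∈ Finset.Icc 1 M, ∑ b ∈ Finset.Icc 1 M, (a:ℝ) * b * max (y - a * b) 0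

set_option maxHeartbeats 1000000 in
theorem FM_big (M : ℕ) (w : ℝ) (hw : 1 ≤ w) (hM : w ^ 2 ≤ M) :
    |FM M (w ^ 2) - w ^ 6 / 6 * (2 * Real.log w + (2 * Real.eulerMascheroniConstant - 5 / 6))| ≤ 7 * w ^ 5 := by
  have hw0 : 0 < w := by linarith
  have h1 := Nat.floor_le hw0.le
  have h2 := Nat.lt_floor_add_one w
  have hn : 1 ≤ ⌊w⌋₊ := Nat.le_floor (by simpa using hw)
  set n := ⌊w⌋₊
  have hww : w ≤ w ^ 2 := by nlinarith
  have hnM : n ≤ M := by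
    have : (n:ℝ) ≤ M := by linarith
    exact_mod_cast this
  have hn' : (1:ℝ) ≤ n := by exact_mod_cast hn
  set A := ∑ a ∈ Finset.Icc 1 n, ∑ b ∈ Finset.Icc 1 M, (a:ℝ) * b * max (w ^ 2 - a * b) 0 with hA
  set D := ∑ a ∈ Finset.Icc 1 n, ∑ b ∈ Finset.Icc 1 n, (a:ℝ) * b * max (w ^ 2 - a * b) 0 with hD
  have hF : FM M (w ^ 2) = 2 * A - D := by
    rw [FM, bb_split M n hnM]
    have e0 : ∀ a ∈ Finset.Icc (n+1) M, ∑ b ∈ Finset.Icc 1 M, (a:ℝ) * b * max (w ^ 2 - a * b) 0 =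
        ∑ b ∈ Finset.Icc 1 n, (a:ℝ) * b * max (w ^ 2 - a * b) 0 := by
      intro a ha
      rw [bb_split M n hnM, add_eq_left]
      apply Finset.sum_eq_zero
      intro b hb
      rw [Finset.mem_Icc] at ha hb
      have ha' : ((n:ℝ) + 1) ≤ a := by exact_mod_cast ha.1
      have hb' : ((n:ℝ) + 1) ≤ b := by exact_mod_cast hb.1
      have : w * w ≤ a * b := mul_le_mul (by linarith) (by linarith) (by linarith) (by linarith)
      rw [max_eq_right (by nlinarith), mul_zero]
    rw [Finset.sum_congr rfl e0, Finset.sum_comm (s := Finset.Icc (n+1) M)]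
    have e1 : A = ∑ b ∈ Finset.Icc 1 n, ∑ a ∈ Finset.Icc 1 M, (a:ℝ) * b * max (w ^ 2 - a * b) 0 := by
      apply Finset.sum_congr rfl
      intro a _
      apply Finset.sum_congr rfl
      intro b _
      rw [mul_comm (a:ℝ) b]
    have e2 : D = ∑ b ∈ Finset.Icc 1 n, ∑ a ∈ Finset.Icc 1 n, (a:ℝ) * b * max (w ^ 2 - a * b) 0 := by
      rw [hD, Finset.sum_comm]
    have e3 : A = D + ∑ b ∈ Finset.Icc 1 n, ∑ a ∈ Finset.Icc (n+1) M, (a:ℝ) * b * max (w ^ 2 - a * b) 0 := by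
      rw [e1, e2, ← Finset.sum_add_distrib]
      apply Finset.sum_congr rfl
      intro b _
      rw [← bb_split M n hnM]
    have : ∑ b ∈ Finset.Icc 1 n, ∑ a ∈ Finset.Icc (n+1) M, (a:ℝ) * b * max (w ^ 2 - a * b) 0 = A - D := by linarith
    rw [this, ← hA]
    ring
  have hD' : D = w ^ 2 * (n * (n + 1) / 2) ^ 2 - (n * (n + 1) * (2 * n + 1) / 6) ^ 2 := by
    rw [← bb_sum1, ← bb_sum2, sq (∑ b ∈ Finset.Icc 1 n, (b:ℝ)), sq (∑ b ∈ Finset.Icc 1 n, (b:ℝ) ^ 2),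
      Finset.sum_mul_sum, Finset.sum_mul_sum, Finset.mul_sum, ← Finset.sum_sub_distrib]
    apply Finset.sum_congr rfl
    intro a ha
    rw [Finset.mul_sum, ← Finset.sum_sub_distrib]
    apply Finset.sum_congr rfl
    intro b hb
    rw [Finset.mem_Icc] at ha hb
    have ha' : (a:ℝ) ≤ n := by exact_mod_cast ha.2
    have hb' : (b:ℝ) ≤ n := by exact_mod_cast hb.2
    have : (a:ℝ) * b ≤ w * w := mul_le_mul (by linarith) (by linarith) (by positivity) (by linarith)
    rw [max_eq_left (by nlinarith)]
    ring
  have hA' : |A - w ^ 6 / 6 * ∑ a ∈ Finset.Icc 1 n, 1 / (a:ℝ)| ≤ w ^ 4 := by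
    have : A - w ^ 6 / 6 * ∑ a ∈ Finset.Icc 1 n, 1 / (a:ℝ) = ∑ a ∈ Finset.Icc 1 n, (a:ℝ) ^ 2 * 
        (∑ b ∈ Finset.Icc 1 M, (b:ℝ) * max (w ^ 2 / a - b) 0 - (w ^ 2 / a) ^ 3 / 6) := by
      rw [hA, Finset.mul_sum, ← Finset.sum_sub_distrib]
      apply Finset.sum_congr rfl
      intro a ha
      rw [Finset.mem_Icc] at ha
      have ha0 : (0:ℝ) < a := by exact_mod_cast ha.1
      rw [mul_sub, Finset.mul_sum]
      congr 1
      · apply Finset.sum_congr rfl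
        intro b _
        have : w ^ 2 - a * b = a * (w ^ 2 / a - b) := by field_simp
        rw [this, ← mul_zero (a:ℝ), ← mul_max_of_nonneg _ _ ha0.le, mul_zero]
        ring
      · field_simp
    rw [this]
    calc _ ≤ ∑ a ∈ Finset.Icc 1 n, |(a:ℝ) ^ 2 * 
        (∑ b ∈ Finset.Icc 1 M, (b:ℝ) * max (w ^ 2 / a - b) 0 - (w ^ 2 / a) ^ 3 / 6)| := Finset.abs_sum_le_sum_abs _ _
      _ ≤ ∑ a ∈ Finset.Icc 1 n, w ^ 2 * (a:ℝ) := by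
        apply Finset.sum_le_sum
        intro a ha
        rw [Finset.mem_Icc] at ha
        have ha0 : (1:ℝ) ≤ a := by exact_mod_cast ha.1
        have ha' : (a:ℝ) ≤ n := by exact_mod_cast ha.2
        rw [abs_mul, abs_of_nonneg (by positivity)]
        have := bb_inner M (w ^ 2 / a) (by rw [le_div_iff₀ (by linarith)]; nlinarith) (by
          rw [div_le_iff₀ (by linarith)]; nlinarith)
        calc _ ≤ (a:ℝ) ^ 2 * (w ^ 2 / a) := mul_le_mul_of_nonneg_left this (by positivity)
          _ = _ := by field_simp
      _ = w ^ 2 * (n * (n + 1) / 2) := by rw [← Finset.mul_sum, bb_sum1]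
      _ ≤ w ^ 2 * (w ^ 2) := by
        apply mul_le_mul_of_nonneg_left _ (by positivity)
        nlinarith
      _ = w ^ 4 := by ring
  have hH := bb_harm w n hn h1 h2.le
  set H := ∑ a ∈ Finset.Icc 1 n, 1 / (a:ℝ)
  have hH' : |w ^ 6 / 6 * H - w ^ 6 / 6 * (Real.log w + Real.eulerMascheroniConstant)| ≤ w ^ 5 / 3 := by
    rw [← mul_sub, abs_mul, abs_of_nonneg (by positivity)]
    calc _ ≤ w ^ 6 / 6 * (2 / w) := mul_le_mul_of_nonneg_left hH (by positivity)
      _ = _ := by field_simp; norm_num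
  have hw4 : w ^ 4 ≤ w ^ 5 := by
    have : 0 ≤ w ^ 4 * (w - 1) := mul_nonneg (by positivity) (by linarith)
    nlinarith
  have hDD : |D - 5 / 36 * w ^ 6| ≤ 3 * w ^ 5 := by
    rw [hD']
    have b1 : |(n * (n + 1) / 2 : ℝ) - w ^ 2 / 2| ≤ w / 2 := by
      rw [abs_le]; constructor <;> nlinarith
    have u1 : (n * (n + 1) : ℝ) ≤ w * (w + 1) := mul_le_mul h1 (by linarith) (by linarith) (by linarith)
    have v1 : (w - 1) * w ≤ (n * (n + 1) : ℝ) := mul_le_mul (by linarith) (by linarith) (by linarith) (by linarith)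
    have u2 : (n * (n + 1) * (2 * n + 1): ℝ) ≤ w * (w + 1) * (2 * w + 1) := mul_le_mul u1 (by linarith) (by linarith) (by positivity)
    have v2 : (w - 1) * w * (2 * w - 1) ≤ (n * (n + 1) * (2 * n + 1): ℝ) := mul_le_mul v1 (by linarith) (by linarith) (by positivity)
    have b2 : |(n * (n + 1) * (2 * n + 1) / 6: ℝ) - w ^ 3 / 3| ≤ w ^ 2 := by
      rw [abs_le]; constructor <;> nlinarith
    set A1 := (n * (n + 1) / 2 : ℝ)
    set A2 := (n * (n + 1) * (2 * n + 1) / 6: ℝ)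
    have p1 : 0 ≤ A1 := by positivity
    have p2 : 0 ≤ A2 := by positivity
    have e : w ^ 2 * A1 ^ 2 - A2 ^ 2 - 5 / 36 * w ^ 6 = 
      w ^ 2 * ((A1 - w ^ 2 / 2) * (A1 + w ^ 2 / 2)) - (A2 - w ^ 3 / 3) * (A2 + w ^ 3 / 3) := by ring
    rw [e]
    have c1 : |w ^ 2 * ((A1 - w ^ 2 / 2) * (A1 + w ^ 2 / 2))| ≤ w ^ 2 * (w / 2 * (2 * w ^ 2)) := by
      rw [abs_mul, abs_mul, abs_of_nonneg (show 0 ≤ w ^ 2 by positivity), abs_of_nonneg (show 0 ≤ A1 + w ^ 2 / 2 by positivity)]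
      apply mul_le_mul_of_nonneg_left _ (by positivity)
      apply mul_le_mul b1 _ (by positivity) (by positivity)
      rw [abs_le] at b1; linarith
    have c2 : |(A2 - w ^ 3 / 3) * (A2 + w ^ 3 / 3)| ≤ w ^ 2 * (2 * w ^ 3) := by
      rw [abs_mul, abs_of_nonneg (show 0 ≤ A2 + w ^ 3 / 3 by positivity)]
      apply mul_le_mul b2 _ (by positivity) (by positivity)
      have : w ^ 2 ≤ w ^ 3 := by nlinarith [mul_nonneg (sq_nonneg w) (show 0 ≤ w - 1 by linarith)]
      rw [abs_le] at b2; linarith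
    calc _ ≤ _ := abs_sub _ _
      _ ≤ w ^ 2 * (w / 2 * (2 * w ^ 2)) + w ^ 2 * (2 * w ^ 3) := add_le_add c1 c2
      _ = _ := by ring
  rw [hF]
  rw [abs_le] at *
  have w5 : 0 ≤ w ^ 5 := by positivity
  constructor <;> linarith

theorem FM_zero (M : ℕ) (y : ℝ) (hy : y ≤ 1) : FM M y = 0 := by
  rw [FM]
  apply Finset.sum_eq_zero
  intro a ha
  apply Finset.sum_eq_zero
  intro b hb
  rw [Finset.mem_Icc] at ha hb
  have ha0 : (1:ℝ) ≤ a := by exact_mod_cast ha.1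
  have hb0 : (1:ℝ) ≤ b := by exact_mod_cast hb.1
  rw [max_eq_right (by nlinarith), mul_zero]

theorem FM_all (M : ℕ) (w : ℝ) (hw : 0 < w) (hM : w ^ 2 ≤ M) :
    |FM M (w ^ 2) - w ^ 6 / 6 * (2 * Real.log w + (2 * Real.eulerMascheroniConstant - 5 / 6))| ≤ 7 * w ^ 5 := by
  rcases le_total 1 w with h | h
  · exact FM_big M w h hM
  rw [FM_zero M _ (by nlinarith), zero_sub, abs_neg]
  have h1 := Real.abs_log_mul_self_lt w hw h
  have g1 := Real.one_half_lt_eulerMascheroniConstant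
  have g2 := Real.eulerMascheroniConstant_lt_two_thirds
  have e : w ^ 6 / 6 * (2 * Real.log w + (2 * Real.eulerMascheroniConstant - 5 / 6)) =
    w ^ 5 * ((2 * (Real.log w * w) + w * (2 * Real.eulerMascheroniConstant - 5 / 6)) / 6) := by ring
  rw [e, abs_mul, abs_of_nonneg (by positivity), mul_comm]
  apply mul_le_mul_of_nonneg_right _ (by positivity)
  rw [abs_lt] at h1
  rw [abs_le]
  constructor <;> nlinarith

theorem bb_totient (n : ℕ) (hn : 0 < n) : (n.totient : ℝ) =
    ∑ x ∈ n.divisorsAntidiagonal, ((ArithmeticFunction.moebius x.1 : ℤ) : ℝ) * (x.2 : ℝ) := by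
  have := (ArithmeticFunction.sum_eq_iff_sum_mul_moebius_eq (R := ℝ) (f := fun n => (n.totient : ℝ))
    (g := fun n => (n:ℝ))).1 (by
      intro n _
      have := Nat.sum_totient n
      exact_mod_cast this)
  exact (this n hn).symm

theorem bb_sum_div (N : ℕ) (h : ℕ → ℕ → ℝ) (hh : ∀ d e, N < d * e → h d e = 0) :
    ∑ n ∈ Finset.Icc 1 N, ∑ x ∈ n.divisorsAntidiagonal, h x.1 x.2 =
    ∑ d ∈ Finset.Icc 1 N, ∑ e ∈ Finset.Icc 1 N, h d e := by
  have hR : ∑ d ∈ Finset.Icc 1 N, ∑ e ∈ Finset.Icc 1 N, h d e =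
      ∑ x ∈ (Finset.Icc 1 N ×ˢ Finset.Icc 1 N).filter (fun x : ℕ × ℕ => x.1 * x.2 ≤ N), h x.1 x.2 := by
    rw [← Finset.sum_product']
    symm
    apply Finset.sum_filter_of_ne
    rintro ⟨d, e⟩ _ hne
    by_contra hlt
    exact hne (hh _ _ (by simpa using hlt))
  rw [hR]
  · rw [← Finset.sum_fiberwise_of_maps_to (t := Finset.Icc 1 N) (g := fun x : ℕ × ℕ => x.1 * x.2)]
    · apply Finset.sum_congr rfl
      intro n hn
      rw [Finset.mem_Icc] at hn
      apply Finset.sum_congr _ (fun _ _ => rfl)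
      ext ⟨d, e⟩
      simp only [Nat.mem_divisorsAntidiagonal, Finset.mem_filter, Finset.mem_product, Finset.mem_Icc]
      constructor
      · rintro ⟨h1, h2⟩
        have hd : 0 < d := Nat.pos_of_ne_zero (by rintro rfl; simp at h1; omega)
        have he : 0 < e := Nat.pos_of_ne_zero (by rintro rfl; simp at h1; omega)
        have := Nat.le_mul_of_pos_right d he
        have := Nat.le_mul_of_pos_left e hd
        omega
      · rintro ⟨h1, h2⟩
        exact ⟨h2, by omega⟩
    · rintro ⟨d, e⟩ hde
      simp only [Finset.mem_filter, Finset.mem_product, Finset.mem_Icc] at hde ⊢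
      exact ⟨Nat.mul_pos hde.1.1.1 hde.1.2.1, hde.2⟩

theorem bb_W (N : ℕ) : ((∑ m ∈ Finset.Icc 1 N, ∑ n ∈ Finset.Icc 1 N, 18 * m * n.totient * (N - m * n) : ℕ) : ℝ) =
    18 * ∑ d ∈ Finset.Icc 1 N, ((ArithmeticFunction.moebius d : ℤ) : ℝ) * (d * FM N (N / d)) := by
  have hsub : ∀ m n : ℕ, ((N - m * n : ℕ) : ℝ) = max ((N:ℝ) - m * n) 0 := by
    intro m n
    rcases le_total (m * n) N with h | h
    · have h' : (m:ℝ) * n ≤ N := by exact_mod_cast h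
      rw [Nat.cast_sub h, max_eq_left (by linarith)]; push_cast; rfl
    · have h' : (N:ℝ) ≤ (m:ℝ) * n := by exact_mod_cast h
      rw [Nat.sub_eq_zero_of_le h, max_eq_right (by linarith)]; simp
  push_cast
  simp only [hsub]
  rw [Finset.sum_comm]
  have : ∀ n ∈ Finset.Icc 1 N, ∑ m ∈ Finset.Icc 1 N, 18 * (m:ℝ) * n.totient * max ((N:ℝ) - m * n) 0 =
      ∑ x ∈ n.divisorsAntidiagonal, (fun d e : ℕ => 18 * ((ArithmeticFunction.moebius d : ℤ) : ℝ) * ∑ m ∈ Finset.Icc 1 N, (m:ℝ) * e * max ((N:ℝ) - m * (d * e)) 0) x.1 x.2 := by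
    intro n hn
    rw [Finset.mem_Icc] at hn
    rw [bb_totient n hn.1]
    simp only [Finset.mul_sum, Finset.sum_mul]
    rw [Finset.sum_comm]
    apply Finset.sum_congr rfl
    intro x hx
    apply Finset.sum_congr rfl
    intro m _
    have hx' := (Nat.mem_divisorsAntidiagonal.1 hx).1
    have : (x.1:ℝ) * x.2 = n := by exact_mod_cast hx'
    rw [this]
    ring
  rw [Finset.sum_congr rfl this, bb_sum_div N (fun d e : ℕ => 18 * ((ArithmeticFunction.moebius d : ℤ) : ℝ) * ∑ m ∈ Finset.Icc 1 N, (m:ℝ) * e * max ((N:ℝ) - m * (d * e)) 0)]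
  · rw [Finset.mul_sum]
    apply Finset.sum_congr rfl
    intro d hd
    rw [Finset.mem_Icc] at hd
    have hd0 : (0:ℝ) < d := by exact_mod_cast hd.1
    rw [← Finset.mul_sum, mul_assoc]
    congr 2
    rw [FM, Finset.sum_comm, Finset.mul_sum]
    apply Finset.sum_congr rfl
    intro e _
    rw [Finset.mul_sum]
    apply Finset.sum_congr rfl
    intro m _
    have : (N:ℝ) - e * (d * m) = d * (N / d - e * m) := by field_simp
    rw [this, ← mul_zero (d:ℝ), ← mul_max_of_nonneg _ _ hd0.le, mul_zero]
    ring
  · intro d e hde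
    beta_reduce
    rw [Finset.sum_eq_zero, mul_zero]
    intro m hm
    rw [Finset.mem_Icc] at hm
    have h1 : (1:ℝ) ≤ m := by exact_mod_cast hm.1
    have h2 : (N:ℝ) ≤ (d:ℝ) * e := by exact_mod_cast hde.le
    have h3 : (0:ℝ) ≤ (d:ℝ) * e := by positivity
    rw [max_eq_right (by nlinarith), mul_zero]

theorem bb_S0 : ∃ S0 S1 : ℝ, HasSum (fun d : ℕ => ((ArithmeticFunction.moebius d : ℤ) : ℝ) / (d:ℝ) ^ 2) S0 ∧
    HasSum (fun d : ℕ => ((ArithmeticFunction.moebius d : ℤ) : ℝ) * Real.log d / (d:ℝ) ^ 2) S1 ∧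
    (S0 : ℂ) = 1 / riemannZeta 2 ∧ (S1 : ℂ) = deriv riemannZeta 2 / riemannZeta 2 ^ 2 := by
  let f : ℕ → ℂ := fun n => ((ArithmeticFunction.moebius n : ℤ) : ℂ)
  have h2 : (1:ℝ) < (2:ℂ).re := by norm_num
  have hab : LSeries.abscissaOfAbsConv f < (2:ℂ).re := by
    change LSeries.abscissaOfAbsConv (fun n => ((ArithmeticFunction.moebius n : ℤ) : ℂ)) < _
    rw [ArithmeticFunction.abscissaOfAbsConv_moebius]; exact_mod_cast h2
  have hs0 : Summable (LSeries.term f 2) := ArithmeticFunction.LSeriesSummable_moebius_iff.2 h2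
  have hs1 : Summable (LSeries.term (LSeries.logMul f) 2) := LSeriesSummable_logMul_of_lt_re hab
  have hz : ∀ s : ℂ, 1 < s.re → LSeries f s = (riemannZeta s)⁻¹ := by
    intro s hs
    have := ArithmeticFunction.LSeries_zeta_mul_Lseries_moebius hs
    rw [ArithmeticFunction.LSeries_zeta_eq_riemannZeta hs] at this
    exact eq_inv_of_mul_eq_one_right this
  have hz2 : riemannZeta 2 ≠ 0 := riemannZeta_ne_zero_of_one_lt_re h2
  have hd : deriv (LSeries f) 2 = - deriv riemannZeta 2 / riemannZeta 2 ^ 2 := by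
    have he : LSeries f =ᶠ[nhds 2] fun s => (riemannZeta s)⁻¹ := by
      have : {s : ℂ | 1 < s.re} ∈ nhds (2:ℂ) := (isOpen_lt continuous_const Complex.continuous_re).mem_nhds h2
      filter_upwards [this] with s hs
      exact hz s hs
    rw [he.deriv_eq]
    have hdd : DifferentiableAt ℂ riemannZeta 2 := differentiableAt_riemannZeta (by norm_num)
    exact (hdd.hasDerivAt.inv hz2).deriv
  have hd' := LSeries_deriv hab
  have e0 : ∀ n, LSeries.term f 2 n = (((ArithmeticFunction.moebius n : ℤ) : ℝ) / (n:ℝ) ^ 2 : ℝ) := by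
    intro n
    rw [LSeries.term_def]
    split_ifs with h
    · simp [h]
    · simp [f]
  have e1 : ∀ n, LSeries.term (LSeries.logMul f) 2 n = (((ArithmeticFunction.moebius n : ℤ) : ℝ) * Real.log n / (n:ℝ) ^ 2 : ℝ) := by
    intro n
    rw [LSeries.term_def]
    split_ifs with h
    · simp [h]
    · simp [f, LSeries.logMul, Complex.natCast_log, mul_comm]
  have r0 : Summable (fun d : ℕ => ((ArithmeticFunction.moebius d : ℤ) : ℝ) / (d:ℝ) ^ 2) := by
    rw [← Complex.summable_ofReal]; exact hs0.congr e0
  have r1 : Summable (fun d : ℕ => ((ArithmeticFunction.moebius d : ℤ) : ℝ) * Real.log d / (d:ℝ) ^ 2) := by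
    rw [← Complex.summable_ofReal]; exact hs1.congr e1
  refine ⟨_, _, r0.hasSum, r1.hasSum, ?_, ?_⟩
  · rw [Complex.ofReal_tsum, one_div, ← hz 2 h2, LSeries]
    exact (tsum_congr e0).symm
  · rw [Complex.ofReal_tsum, ← tsum_congr e1]
    rw [hd, LSeries] at hd'
    rw [neg_div] at hd'
    exact (neg_injective hd').symm

theorem bb_main (S0 S1 : ℝ) (h0 : HasSum (fun d : ℕ => ((ArithmeticFunction.moebius d : ℤ) : ℝ) / (d:ℝ) ^ 2) S0)
    (h1 : HasSum (fun d : ℕ => ((ArithmeticFunction.moebius d : ℤ) : ℝ) * Real.log d / (d:ℝ) ^ 2) S1) :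
    ∃ K : ℝ, ∀ N : ℕ, 1 ≤ N → 
    |∑ d ∈ Finset.Icc 1 N, ((ArithmeticFunction.moebius d : ℤ) : ℝ) * (d * FM N (N / d)) -
      (N:ℝ) ^ 3 / 6 * ((Real.log N + (2 * Real.eulerMascheroniConstant - 5 / 6)) * S0 - S1)| ≤ K * (Real.sqrt N) ^ 5 := by
  set c := 2 * Real.eulerMascheroniConstant - 5 / 6 with hc
  have hsum : Summable (fun d : ℕ => 1 / (d:ℝ) ^ (3/2 : ℝ)) := Real.summable_one_div_nat_rpow.2 (by norm_num)
  refine ⟨7 * ∑' d : ℕ, 1 / (d:ℝ) ^ (3/2 : ℝ), ?_⟩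
  intro N hN
  have hN0 : (0:ℝ) < N := by exact_mod_cast hN
  have hG : HasSum (fun d : ℕ => ((ArithmeticFunction.moebius d : ℤ) : ℝ) * (d * FM N (N / d)))
      (∑ d ∈ Finset.Icc 1 N, ((ArithmeticFunction.moebius d : ℤ) : ℝ) * (d * FM N (N / d))) := by
    apply hasSum_sum_of_ne_finset_zero
    intro d hd
    rcases Nat.eq_zero_or_pos d with rfl | hp
    · simp
    · have : N < d := by
        by_contra hh; exact hd (Finset.mem_Icc.2 ⟨hp, by omega⟩)
      have : (N:ℝ) ≤ d := by exact_mod_cast this.le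
      have hp' : (0:ℝ) < d := by exact_mod_cast hp
      rw [FM_zero N _ (by rw [div_le_one hp']; exact this)]
      simp
  have hM : HasSum (fun d : ℕ => (N:ℝ) ^ 3 / 6 * ((Real.log N + c) * (((ArithmeticFunction.moebius d : ℤ) : ℝ) / (d:ℝ) ^ 2) -
      ((ArithmeticFunction.moebius d : ℤ) : ℝ) * Real.log d / (d:ℝ) ^ 2)) ((N:ℝ) ^ 3 / 6 * ((Real.log N + c) * S0 - S1)) :=
    ((h0.mul_left _).sub h1).mul_left _
  have hdiff := hG.sub hM
  have hb : HasSum (fun d : ℕ => 7 * (1 / (d:ℝ) ^ (3/2 : ℝ)) * (Real.sqrt N) ^ 5) (7 * (∑' d : ℕ, 1 / (d:ℝ) ^ (3/2 : ℝ)) * (Real.sqrt N) ^ 5) :=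
    (hsum.hasSum.mul_left _).mul_right _
  rw [← Real.norm_eq_abs]
  apply hdiff.norm_le_of_bounded hb
  intro d
  rcases Nat.eq_zero_or_pos d with rfl | hp
  · simp
  have hd0 : (0:ℝ) < d := by exact_mod_cast hp
  have hd1 : (1:ℝ) ≤ d := by exact_mod_cast hp
  have sN : 0 < Real.sqrt N := Real.sqrt_pos.2 hN0
  have sd : 0 < Real.sqrt d := Real.sqrt_pos.2 hd0
  have qN : Real.sqrt N ^ 2 = N := Real.sq_sqrt hN0.le
  have qd : Real.sqrt d ^ 2 = d := Real.sq_sqrt hd0.le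
  have lN : Real.log N = 2 * Real.log (Real.sqrt N) := by rw [Real.log_sqrt hN0.le]; ring
  have ld : Real.log d = 2 * Real.log (Real.sqrt d) := by rw [Real.log_sqrt hd0.le]; ring
  have hr : (d:ℝ) ^ (3/2 : ℝ) = Real.sqrt d ^ 3 := by
    rw [Real.sqrt_eq_rpow, ← Real.rpow_natCast, ← Real.rpow_mul hd0.le]; norm_num
  rw [hr, lN, ld]
  set u := Real.sqrt N
  set v := Real.sqrt d
  have hF := FM_all N (u / v) (by positivity) (by
    rw [div_pow, qN, qd, div_le_iff₀ hd0]; nlinarith)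
  rw [← hc, Real.log_div sN.ne' sd.ne', div_pow u v 2, qN, qd] at hF
  rw [Real.norm_eq_abs]
  have e : ((ArithmeticFunction.moebius d : ℤ) : ℝ) * (d * FM N (N / d)) - (N:ℝ) ^ 3 / 6 * ((2 * Real.log u + c) * (((ArithmeticFunction.moebius d : ℤ) : ℝ) / (d:ℝ) ^ 2) -
      ((ArithmeticFunction.moebius d : ℤ) : ℝ) * (2 * Real.log v) / (d:ℝ) ^ 2) =
     ((ArithmeticFunction.moebius d : ℤ) : ℝ) * (v ^ 2 * (FM N (N / d) - (u / v) ^ 6 / 6 * (2 * (Real.log u - Real.log v) + c))) := by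
    generalize FM N (N / d) = φ
    rw [← qN, ← qd]
    field_simp
    ring
  rw [e, abs_mul, abs_mul]
  have hmu : |((ArithmeticFunction.moebius d : ℤ) : ℝ)| ≤ 1 := by
    have := ArithmeticFunction.abs_moebius_le_one (n := d)
    exact_mod_cast this
  calc _ ≤ 1 * (|v ^ 2| * (7 * (u / v) ^ 5)) := by
        apply mul_le_mul hmu _ (by positivity) (by norm_num)
        exact mul_le_mul_of_nonneg_left hF (by positivity)
    _ = _ := by
        rw [abs_of_nonneg (by positivity)]
        field_simp

theorem bb_real (S0 S1 : ℝ) (h0 : HasSum (fun d : ℕ => ((ArithmeticFunction.moebius d : ℤ) : ℝ) / (d:ℝ) ^ 2) S0)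
    (h1 : HasSum (fun d : ℕ => ((ArithmeticFunction.moebius d : ℤ) : ℝ) * Real.log d / (d:ℝ) ^ 2) S1) :
    ∃ C : ℝ, ∀ X : ℝ, 3 ≤ X →
    |(J 3 2 X : ℝ) - 3 * X ^ 3 * ((Real.log X + (2 * Real.eulerMascheroniConstant - 5 / 6)) * S0 - S1)| ≤
      C * X ^ ((5:ℝ) / 2) * Real.log X := by
  obtain ⟨K, hK⟩ := bb_main S0 S1 h0 h1
  set c := 2 * Real.eulerMascheroniConstant - 5 / 6 with hc
  refine ⟨18 * |K| + 1 + 9 * ((1 + |c|) * |S0| + |S1|) + 3 * |S0|, ?_⟩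
  intro X hX
  have hX0 : (0:ℝ) < X := by linarith
  rw [J_eq X (by linarith)]
  set N := ⌊X⌋₊ with hNdef
  have hN1 : 1 ≤ N := Nat.le_floor (by norm_num; linarith)
  have hN0 : (0:ℝ) < N := by exact_mod_cast hN1
  have hNX : (N:ℝ) ≤ X := Nat.floor_le hX0.le
  have hXN : X < N + 1 := Nat.lt_floor_add_one X
  have hL : 1 ≤ Real.log X := by
    rw [Real.le_log_iff_exp_le hX0]
    have := Real.exp_one_lt_d9
    linarith
  have hs : X ^ ((5:ℝ) / 2) = Real.sqrt X ^ 5 := by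
    rw [Real.sqrt_eq_rpow, ← Real.rpow_natCast, ← Real.rpow_mul hX0.le]; norm_num
  rw [hs, Nat.cast_add, bb_W]
  have hk := hK N hN1
  generalize ∑ d ∈ Finset.Icc 1 N, ((ArithmeticFunction.moebius d : ℤ) : ℝ) * (d * FM N (N / d)) = W at hk ⊢
  set s := Real.sqrt X with hsd
  have qs : s ^ 2 = X := Real.sq_sqrt hX0.le
  have s1 : 1 ≤ s := Real.one_le_sqrt.2 (by linarith)
  have sN : Real.sqrt N ≤ s := Real.sqrt_le_sqrt hNX
  have hk2 : |W - (N:ℝ) ^ 3 / 6 * ((Real.log N + c) * S0 - S1)| ≤ |K| * s ^ 5 := by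
    refine hk.trans ?_
    exact mul_le_mul (le_abs_self K) (pow_le_pow_left₀ (Real.sqrt_nonneg _) sN 5) (by positivity) (abs_nonneg _)
  have hs5 : 0 < s ^ 5 := by positivity
  have hX2 : X ^ 2 ≤ s ^ 5 := by
    rw [← qs, ← pow_mul]; exact pow_le_pow_right₀ s1 (by norm_num)
  have hX1 : X ≤ s ^ 5 := by
    nth_rewrite 1 [← qs]; exact pow_le_pow_right₀ s1 (by norm_num)
  set L := Real.log X
  have hlog : |N * (L - Real.log N)| ≤ 1 := by
    have h1 : Real.log N ≤ L := Real.log_le_log hN0 hNX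
    rw [abs_of_nonneg (mul_nonneg hN0.le (by linarith)), ← Real.log_div hX0.ne' hN0.ne']
    have h2 := Real.log_le_sub_one_of_pos (div_pos hX0 hN0)
    calc (N:ℝ) * Real.log (X / N) ≤ N * (X / N - 1) := mul_le_mul_of_nonneg_left h2 hN0.le
      _ = X - N := by field_simp
      _ ≤ 1 := by linarith
  have hcube : |X ^ 3 - (N:ℝ) ^ 3| ≤ 3 * X ^ 2 := by
    have h3 : (N:ℝ) ^ 3 ≤ X ^ 3 := pow_le_pow_left₀ hN0.le hNX 3
    rw [abs_of_nonneg (by linarith)]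
    have : X ^ 3 - (N:ℝ) ^ 3 = (X - N) * (X ^ 2 + X * N + N ^ 2) := by ring
    rw [this]
    have h4 : X ^ 2 + X * N + (N:ℝ) ^ 2 ≤ 3 * X ^ 2 := by nlinarith
    have h5 : 0 ≤ X ^ 2 + X * N + (N:ℝ) ^ 2 := by positivity
    nlinarith
  have hA : |(L + c) * S0 - S1| ≤ ((1 + |c|) * |S0| + |S1|) * L := by
    calc |(L + c) * S0 - S1| ≤ |(L + c) * S0| + |S1| := abs_sub _ _
      _ ≤ (L + |c|) * |S0| + |S1| := by
        rw [abs_mul]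
        have := abs_add_le L c
        rw [abs_of_nonneg (by linarith : (0:ℝ) ≤ L)] at this
        have := mul_le_mul_of_nonneg_right this (abs_nonneg S0)
        linarith
      _ ≤ _ := by
        have := mul_nonneg (mul_nonneg (abs_nonneg c) (abs_nonneg S0)) (sub_nonneg.2 hL)
        have := mul_nonneg (abs_nonneg S1) (sub_nonneg.2 hL)
        nlinarith
  have e : (N:ℝ) + 18 * W - 3 * X ^ 3 * ((L + c) * S0 - S1) =
      N + 18 * (W - (N:ℝ) ^ 3 / 6 * ((Real.log N + c) * S0 - S1)) - 3 * ((X ^ 3 - (N:ℝ) ^ 3) * ((L + c) * S0 - S1))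
      - 3 * ((N:ℝ) ^ 2 * S0 * (N * (L - Real.log N))) := by ring
  rw [e]
  set Q := W - (N:ℝ) ^ 3 / 6 * ((Real.log N + c) * S0 - S1)
  have t1 : |(X ^ 3 - (N:ℝ) ^ 3) * ((L + c) * S0 - S1)| ≤ 3 * s ^ 5 * (((1 + |c|) * |S0| + |S1|) * L) := by
    rw [abs_mul]
    exact mul_le_mul (by linarith) hA (abs_nonneg _) (by positivity)
  have t2 : |(N:ℝ) ^ 2 * S0 * (N * (L - Real.log N))| ≤ s ^ 5 * |S0| * 1 := by
    rw [abs_mul, abs_mul, abs_of_nonneg (by positivity : (0:ℝ) ≤ (N:ℝ) ^ 2)]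
    have h6 : (N:ℝ) ^ 2 ≤ s ^ 5 := (pow_le_pow_left₀ hN0.le hNX 2).trans hX2
    exact mul_le_mul (mul_le_mul_of_nonneg_right h6 (abs_nonneg _)) hlog (abs_nonneg _) (by positivity)
  have t3 : s ^ 5 * |S0| ≤ s ^ 5 * |S0| * L := le_mul_of_one_le_right (by positivity) hL
  have t4 : |K| * s ^ 5 ≤ |K| * s ^ 5 * L := le_mul_of_one_le_right (by positivity) hL
  have t5 : s ^ 5 ≤ s ^ 5 * L := le_mul_of_one_le_right (by positivity) hL
  generalize (X ^ 3 - (N:ℝ) ^ 3) * ((L + c) * S0 - S1) = T1 at t1 ⊢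
  generalize (N:ℝ) ^ 2 * S0 * (N * (L - Real.log N)) = T2 at t2 ⊢
  have r : (18 * |K| + 1 + 9 * ((1 + |c|) * |S0| + |S1|) + 3 * |S0|) * s ^ 5 * L =
     18 * (|K| * s ^ 5 * L) + s ^ 5 * L + 3 * (3 * s ^ 5 * (((1 + |c|) * |S0| + |S1|) * L)) + 3 * (s ^ 5 * |S0| * L) := by ring
  rw [r]
  rw [abs_le] at hk2 t1 t2 ⊢
  constructor <;> linarith [hk2.1, hk2.2, t1.1, t1.2, t2.1, t2.2]

theorem blomer_bruedern_asymptotic :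
    ∃ C X₀ : ℝ, ∀ X : ℝ, X ≥ X₀ →
      ‖(J 3 2 X : ℂ) -
          ((18 / (Real.pi : ℂ) ^ 2) * (X : ℂ) ^ 3 * (Real.log X : ℂ) +
            (3 / (Real.pi : ℂ) ^ 2) *
              (12 * (Real.eulerMascheroniConstant : ℂ) -
                6 * deriv riemannZeta 2 / riemannZeta 2 - 5) * (X : ℂ) ^ 3)‖ ≤
        C * X ^ ((5 : ℝ) / 2) * Real.log X := by
  obtain ⟨S0, S1, h0, h1, z0, z1⟩ := bb_S0
  obtain ⟨C, hC⟩ := bb_real S0 S1 h0 h1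
  refine ⟨C, 3, fun X hX => ?_⟩
  have := hC X hX
  rw [← Real.norm_eq_abs, ← Complex.norm_real] at this
  convert this using 2
  push_cast
  rw [z0, z1, riemannZeta_two]
  have hpi : (Real.pi : ℂ) ≠ 0 := by exact_mod_cast Real.pi_ne_zero
  generalize deriv riemannZeta 2 = D
  field_simp
  ring
end

section
/- Let k ≥ 2 be a natural number. For every ε > 0 there is a constant C(k,ε) such that for all real X ≥ 1 one has J_{k+1,k}(X) ≤ C(k,ε) · X^{k+1+ε}. -/
lemma hua_divisor_bound (δ : ℝ) (hδ : 0 < δ) :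
    ∃ C : ℝ, 0 ≤ C ∧ ∀ n : ℕ, n ≠ 0 → (n.divisors.card : ℝ) ≤ C * (n : ℝ) ^ δ := by
  have hl2 : 0 < Real.log 2 := Real.log_pos (by norm_num)
  have hdl : 0 < δ * Real.log 2 := mul_pos hδ hl2
  set K : ℝ := 1 + 1 / (δ * Real.log 2) with hK
  have hK1 : 1 ≤ K := by rw [hK]; have := (one_div_pos.2 hdl); linarith
  obtain ⟨P, hP⟩ := exists_nat_ge ((2 : ℝ) ^ (1 / δ))
  refine ⟨K ^ P, by positivity, fun n hn => ?_⟩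
  have hprod : ((n : ℝ)) ^ δ = ∏ p ∈ n.primeFactors, ((p : ℝ) ^ δ) ^ (n.factorization p) := by
    conv_lhs => rw [← Nat.prod_factorization_pow_eq_self hn]
    rw [Finsupp.prod, Nat.support_factorization]
    push_cast
    rw [← Real.finsetProd_rpow _ _ (fun i _ => by positivity)]
    refine Finset.prod_congr rfl fun p _ => ?_
    rw [← Real.rpow_natCast, ← Real.rpow_natCast, ← Real.rpow_mul (by positivity),
      ← Real.rpow_mul (by positivity), mul_comm]
  rw [Nat.card_divisors hn, hprod]
  push_cast
  have hterm : ∀ p ∈ n.primeFactors, ((n.factorization p : ℝ) + 1) ≤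
      (if p < P then K else 1) * ((p : ℝ) ^ δ) ^ (n.factorization p) := by
    intro p hp
    have hp2 : (2 : ℝ) ≤ p := by exact_mod_cast (Nat.prime_of_mem_primeFactors hp).two_le
    set a := n.factorization p
    split_ifs with h
    · have h1 : (2 : ℝ) ^ δ ≤ (p : ℝ) ^ δ := Real.rpow_le_rpow (by norm_num) hp2 hδ.le
      have h2 : 1 + (a : ℝ) * (δ * Real.log 2) ≤ ((2 : ℝ) ^ δ) ^ a := by
        rw [Real.rpow_def_of_pos (by norm_num), ← Real.exp_nat_mul]
        have := Real.add_one_le_exp ((a : ℝ) * (Real.log 2 * δ))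
        linarith
      have h3 : ((2 : ℝ) ^ δ) ^ a ≤ ((p : ℝ) ^ δ) ^ a := by gcongr
      have h4 : (a : ℝ) + 1 ≤ K * (1 + (a : ℝ) * (δ * Real.log 2)) := by
        have : K * (1 + (a : ℝ) * (δ * Real.log 2))
          = 1 + 1 / (δ * Real.log 2) + a * (δ * Real.log 2) + a := by
          rw [hK]; field_simp; ring
        rw [this]
        have : 0 ≤ (a : ℝ) * (δ * Real.log 2) := by positivity
        have := (one_div_pos.2 hdl)
        linarith
      calc (a : ℝ) + 1 ≤ K * (1 + (a : ℝ) * (δ * Real.log 2)) := h4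
        _ ≤ K * ((p : ℝ) ^ δ) ^ a := by gcongr; linarith
    · push Not at h
      have h1 : (2 : ℝ) ≤ (p : ℝ) ^ δ := by
        have : (2 : ℝ) ^ (1 / δ) ≤ p := hP.trans (by exact_mod_cast h)
        calc (2 : ℝ) = ((2 : ℝ) ^ (1 / δ)) ^ δ := by
              rw [← Real.rpow_mul (by norm_num), one_div_mul_cancel hδ.ne', Real.rpow_one]
          _ ≤ _ := Real.rpow_le_rpow (by positivity) this hδ.le
      have h2 : ((a : ℝ) + 1) ≤ 2 ^ a := by
        exact_mod_cast (Nat.lt_two_pow_self (n := a))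
      rw [one_mul]
      exact h2.trans (by gcongr)
  refine (Finset.prod_le_prod (fun i _ => by positivity) hterm).trans ?_
  rw [Finset.prod_mul_distrib]
  gcongr
  rw [Finset.prod_ite, Finset.prod_const, Finset.prod_const_one, mul_one]
  refine pow_le_pow_right₀ hK1 ?_
  calc _ ≤ (Finset.range P).card := Finset.card_le_card (by
        intro p hp; simp only [Finset.mem_filter] at hp; simpa using hp.2)
    _ = P := by simp

lemma hua_esymm_eq {m k : ℕ} (x y : Fin m → ℤ)
    (h : ∀ j ∈ Finset.Icc 1 k, ∑ i, x i ^ j = ∑ i, y i ^ j) (j : ℕ) (hj : j ≤ k) :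
    MvPolynomial.aeval x (MvPolynomial.esymm (Fin m) ℤ j) =
      MvPolynomial.aeval y (MvPolynomial.esymm (Fin m) ℤ j) := by
  induction j using Nat.strong_induction_on with
  | _ j ih =>
    rcases Nat.eq_zero_or_pos j with rfl | hpos
    · simp
    have hx := congrArg (MvPolynomial.aeval x) (MvPolynomial.mul_esymm_eq_sum (Fin m) ℤ j)
    have hy := congrArg (MvPolynomial.aeval y) (MvPolynomial.mul_esymm_eq_sum (Fin m) ℤ j)
    simp only [map_mul, map_sum, map_pow, map_neg, map_one, map_natCast] at hx hy
    have hj0 : (j : ℤ) ≠ 0 := by exact_mod_cast hpos.ne'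
    apply mul_left_cancel₀ hj0
    rw [hx, hy]
    congr 1
    refine Finset.sum_congr rfl fun a ha => ?_
    have ha := Finset.mem_filter.1 ha
    have ha' := Finset.HasAntidiagonal.mem_antidiagonal.1 ha.1
    rw [ih a.1 ha.2 (by omega)]
    congr 1
    simp only [MvPolynomial.psum, map_sum, map_pow, MvPolynomial.aeval_X]
    exact h _ (Finset.mem_Icc.2 ⟨by omega, by omega⟩)

open Polynomial in
lemma hua_poly {k : ℕ} (x y : Fin (k + 1) → ℤ)
    (h : ∀ j ∈ Finset.Icc 1 k, ∑ i, x i ^ j = ∑ i, y i ^ j) :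
    ∃ c : ℤ, ∏ i, ((X : ℤ[X]) - C (x i)) = ∏ i, (X - C (y i)) + C c := by
  have key : ∀ z : Fin (k + 1) → ℤ, ∏ i, ((X : ℤ[X]) - C (z i)) =
      ∑ j ∈ Finset.range (k + 2), (-1) ^ j * (C (MvPolynomial.aeval z (MvPolynomial.esymm (Fin (k+1)) ℤ j)) * X ^ (k + 1 - j)) := by
    intro z
    have := Multiset.prod_X_sub_X_eq_sum_esymm (Finset.univ.val.map z)
    simp only [Multiset.map_map, Multiset.card_map, Finset.card_val, Finset.card_univ, Fintype.card_fin] at this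
    simp only [MvPolynomial.aeval_esymm_eq_multiset_esymm]
    exact this
  refine ⟨(-1) ^ (k+1) * (MvPolynomial.aeval x (MvPolynomial.esymm (Fin (k+1)) ℤ (k+1)) - MvPolynomial.aeval y (MvPolynomial.esymm (Fin (k+1)) ℤ (k+1))), ?_⟩
  rw [key x, key y, Finset.sum_range_succ, Finset.sum_range_succ _ (k+1)]
  have : ∀ j ∈ Finset.range (k+1), (-1 : ℤ[X]) ^ j * (C (MvPolynomial.aeval x (MvPolynomial.esymm (Fin (k+1)) ℤ j)) * X ^ (k + 1 - j)) = (-1) ^ j * (C (MvPolynomial.aeval y (MvPolynomial.esymm (Fin (k+1)) ℤ j)) * X ^ (k + 1 - j)) := by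
    intro j hj
    rw [hua_esymm_eq x y h j (by simpa [Nat.lt_succ_iff] using hj)]
  rw [Finset.sum_congr rfl this]
  simp
  ring

open Polynomial in
lemma hua_perm {m : ℕ} (x y : Fin m → ℤ)
    (h : ∏ i, ((X : ℤ[X]) - C (x i)) = ∏ i, (X - C (y i))) :
    ∃ σ : Equiv.Perm (Fin m), y = x ∘ σ := by
  have hr : ∀ z : Fin m → ℤ, (∏ i, ((X : ℤ[X]) - C (z i))).roots = Finset.univ.val.map z := by
    intro z
    rw [← roots_multiset_prod_X_sub_C (Finset.univ.val.map z), Multiset.map_map]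
    rfl
  have h2 : Finset.univ.val.map x = Finset.univ.val.map y := by rw [← hr, ← hr, h]
  have e : ∀ z : ℤ, Nonempty ({i // y i = z} ≃ {i // x i = z}) := by
    intro z
    have h4 := congrArg (Multiset.count z) h2
    rw [Multiset.count_map, Multiset.count_map] at h4
    refine ⟨Fintype.equivOfCardEq ?_⟩
    rw [Fintype.card_subtype, Fintype.card_subtype]
    simpa [Finset.card_def, Finset.filter_val, eq_comm] using h4.symm
  let e := fun z => (e z).some
  refine ⟨(Equiv.sigmaFiberEquiv y).symm.trans
    ((Equiv.sigmaCongrRight e).trans (Equiv.sigmaFiberEquiv x)), ?_⟩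
  funext i
  exact ((e (y i) ⟨i, rfl⟩).2).symm

/-- The structural dichotomy. -/
lemma hua_dich {k : ℕ} (x y : Fin (k + 1) → ℤ)
    (h : ∀ j ∈ Finset.Icc 1 k, ∑ i, x i ^ j = ∑ i, y i ^ j)
    (hn : ¬ ∃ σ : Equiv.Perm (Fin (k + 1)), y = x ∘ σ) :
    ∏ i : Fin k, (y (Fin.last k) - x i.castSucc) ≠ 0 ∧
    ∀ j : Fin k, (x (Fin.last k) - y j.castSucc) ∣ ∏ i : Fin k, (y (Fin.last k) - x i.castSucc) := by
  obtain ⟨c, hc⟩ := hua_poly x y h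
  have hc0 : c ≠ 0 := by
    rintro rfl
    exact hn (hua_perm x y (by simpa using hc))
  have ev : ∀ t : ℤ, ∏ i, (t - x i) = ∏ i, (t - y i) + c := by
    intro t
    have := congrArg (Polynomial.eval t) hc
    simpa [Polynomial.eval_prod] using this
  have e1 := ev (y (Fin.last k))
  rw [Finset.prod_eq_zero (f := fun i => y (Fin.last k) - y i) (Finset.mem_univ (Fin.last k)) (by simp),
    zero_add, Fin.prod_univ_castSucc] at e1
  have e2 := ev (x (Fin.last k))
  rw [Finset.prod_eq_zero (f := fun i => x (Fin.last k) - x i) (Finset.mem_univ (Fin.last k)) (by simp),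
    Fin.prod_univ_castSucc] at e2
  have hne : y (Fin.last k) - x (Fin.last k) ≠ 0 := by
    intro h0; rw [h0, mul_zero] at e1; exact hc0 e1.symm
  refine ⟨fun h0 => ?_, fun j => ?_⟩
  · rw [h0, zero_mul] at e1; exact hc0 e1.symm
  · have : ∏ i : Fin k, (y (Fin.last k) - x i.castSucc) = ∏ i : Fin k, (x (Fin.last k) - y i.castSucc) := by
      apply mul_right_cancel₀ hne
      linarith
    rw [this]
    exact Finset.dvd_prod_of_mem _ (Finset.mem_univ j)

theorem hua_k_plus_one (k : ℕ) (hk : 2 ≤ k) (ε : ℝ) (hε : ε > 0) :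
    ∃ C : ℝ, ∀ X : ℝ, X ≥ 1 → (J (k + 1) k X : ℝ) ≤ C * X ^ ((k : ℝ) + 1 + ε) := by
  classical
  have hk0 : (0 : ℝ) < k := by exact_mod_cast (by omega : 0 < k)
  obtain ⟨C, hC0, hC⟩ := hua_divisor_bound (ε / k ^ 2) (by positivity)
  refine ⟨(k + 1).factorial + (2 * C) ^ k, fun X hX => ?_⟩
  have hX0 : 0 < X := by linarith
  set N : ℕ := ⌊X⌋₊ with hN
  have hNX : (N : ℝ) ≤ X := Nat.floor_le hX0.le
  set B : Finset ℤ := Finset.Icc 1 (N : ℤ) with hB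
  have hBc : B.card = N := by simp [hB]
  have hmem : ∀ z : ℤ, 1 ≤ z → (z : ℝ) ≤ X → z ∈ B := by
    intro z h1 h2
    refine Finset.mem_Icc.2 ⟨h1, ?_⟩
    lift z to ℕ using by omega
    have : z ≤ ⌊X⌋₊ := Nat.le_floor (by simpa using h2)
    exact_mod_cast this
  set S := {p : (Fin (k+1) → ℤ) × (Fin (k+1) → ℤ) |
    (∀ i, 1 ≤ p.1 i ∧ (p.1 i : ℝ) ≤ X) ∧ (∀ i, 1 ≤ p.2 i ∧ (p.2 i : ℝ) ≤ X) ∧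
    ∀ j ∈ Finset.Icc 1 k, ∑ i, p.1 i ^ j = ∑ i, p.2 i ^ j} with hS
  set D := {p : (Fin (k+1) → ℤ) × (Fin (k+1) → ℤ) | ∃ σ : Equiv.Perm (Fin (k + 1)), p.2 = p.1 ∘ σ} with hD
  have hJ : J (k+1) k X = S.ncard := rfl
  -- diagonal part
  have hdiag : (S ∩ D).ncard ≤ N ^ (k+1) * (k+1).factorial := by
    let T : Finset ((Fin (k+1) → ℤ) × Equiv.Perm (Fin (k+1))) :=
      (Fintype.piFinset fun _ => B) ×ˢ Finset.univ
    have hsub : S ∩ D ⊆ ↑(T.image fun q => (q.1, q.1 ∘ q.2)) := by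
      rintro ⟨x, y⟩ ⟨⟨hx, -, -⟩, σ, hσ⟩
      simp only [Finset.coe_image, Set.mem_image]
      refine ⟨(x, σ), ?_, ?_⟩
      · simp only [T, Finset.coe_product, Finset.mem_coe, Set.mem_prod, Fintype.mem_piFinset, Finset.mem_univ, and_true]
        exact fun i => hmem _ (hx i).1 (hx i).2
      · simp only at hσ; simp [hσ]
    calc (S ∩ D).ncard ≤ Set.ncard (↑(T.image fun q => (q.1, q.1 ∘ q.2)) : Set ((Fin (k+1) → ℤ) × (Fin (k+1) → ℤ))) :=
          Set.ncard_le_ncard hsub (Finset.finite_toSet _)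
      _ ≤ T.card := by rw [Set.ncard_coe_finset]; exact Finset.card_image_le
      _ = _ := by simp [T, hBc, Fintype.card_perm]
  -- off-diagonal part
  let nn : (Fin k → ℤ) × ℤ → ℤ := fun q => ∏ i, (q.2 - q.1 i)
  let dv : ℤ → Finset ℤ := fun n =>
    n.natAbs.divisors.image (fun d : ℕ => (d : ℤ)) ∪ n.natAbs.divisors.image (fun d : ℕ => -(d : ℤ))
  let A : Finset ((Fin k → ℤ) × ℤ) := (Fintype.piFinset fun _ => B) ×ˢ B
  let E : Finset (((Fin k → ℤ) × ℤ) × (Fin k → ℤ)) :=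
    A.biUnion fun q => (Fintype.piFinset fun _ : Fin k => dv (nn q)).image fun d => (q, d)
  have hdvc : ∀ n : ℤ, (dv n).card ≤ 2 * n.natAbs.divisors.card := by
    intro n
    refine (Finset.card_union_le _ _).trans ?_
    have h1 := Finset.card_image_le (s := n.natAbs.divisors) (f := fun d : ℕ => (d : ℤ))
    have h2 := Finset.card_image_le (s := n.natAbs.divisors) (f := fun d : ℕ => -(d : ℤ))
    omega
  have hdvm : ∀ n d : ℤ, n ≠ 0 → d ∣ n → d ∈ dv n := by
    intro n d hn hd
    have h1 : d.natAbs ∈ n.natAbs.divisors :=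
      Nat.mem_divisors.2 ⟨Int.natAbs_dvd_natAbs.2 hd, by simpa using hn⟩
    rcases Int.natAbs_eq d with h | h
    · exact Finset.mem_union_left _ (Finset.mem_image.2 ⟨_, h1, h.symm⟩)
    · exact Finset.mem_union_right _ (Finset.mem_image.2 ⟨_, h1, h.symm⟩)
  have hoff : (S \ D).ncard ≤ E.card := by
    rw [← Set.ncard_coe_finset]
    refine Set.ncard_le_ncard_of_injOn
      (fun p => ((fun i => p.1 i.castSucc, p.2 (Fin.last k)), fun j => p.1 (Fin.last k) - p.2 j.castSucc)) ?_ ?_ (Finset.finite_toSet _)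
    · rintro ⟨x, y⟩ ⟨⟨hx, hy, hxy⟩, hnd⟩
      obtain ⟨h0, hdvd⟩ := hua_dich x y hxy hnd
      simp only [E, Finset.mem_coe, Finset.mem_biUnion, Finset.mem_image]
      refine ⟨(fun i => x i.castSucc, y (Fin.last k)), ?_, _, ?_, rfl⟩
      · simp only [A, Finset.mem_product, Fintype.mem_piFinset]
        exact ⟨fun i => hmem _ (hx _).1 (hx _).2, hmem _ (hy _).1 (hy _).2⟩
      · rw [Fintype.mem_piFinset]
        exact fun j => hdvm _ _ h0 (hdvd j)
    · rintro ⟨x, y⟩ ⟨⟨-, -, hxy⟩, -⟩ ⟨x', y'⟩ ⟨⟨-, -, hxy'⟩, -⟩ heq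
      simp only [Prod.mk.injEq] at heq
      obtain ⟨⟨h1, h2⟩, h3⟩ := heq
      have h1 := fun i => congrFun h1 i
      have h3 := fun i => congrFun h3 i
      simp only at h1 h3 hxy hxy'
      have s := hxy 1 (Finset.mem_Icc.2 ⟨le_rfl, by omega⟩)
      have s' := hxy' 1 (Finset.mem_Icc.2 ⟨le_rfl, by omega⟩)
      simp only [pow_one, Fin.sum_univ_castSucc] at s s'
      have t : ∑ i : Fin k, y i.castSucc = ∑ i : Fin k, y' i.castSucc + k * (x (Fin.last k) - x' (Fin.last k)) := by
        have : ∀ i : Fin k, y i.castSucc = y' i.castSucc + (x (Fin.last k) - x' (Fin.last k)) := fun i => by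
          have := h3 i; linarith
        rw [Finset.sum_congr rfl fun i _ => this i, Finset.sum_add_distrib]
        simp
        ring
      have u : ∑ i : Fin k, x i.castSucc = ∑ i : Fin k, x' i.castSucc := Finset.sum_congr rfl fun i _ => h1 i
      have hz : ((k : ℤ) - 1) * (x (Fin.last k) - x' (Fin.last k)) = 0 := by linarith
      have hxl : x (Fin.last k) = x' (Fin.last k) := by
        rcases mul_eq_zero.1 hz with h | h
        · omega
        · omega
      have hxx : x = x' := by
        funext i
        induction i using Fin.lastCases with
        | last => exact hxl
        | cast i => exact h1 i
      have hyy : y = y' := by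
        funext i
        induction i using Fin.lastCases with
        | last => exact h2
        | cast i => have := h3 i; linarith
      rw [hxx, hyy]
  have hXp : (1 : ℝ) ≤ X ^ ε := Real.one_le_rpow hX hε.le
  have hAc : A.card = N ^ (k + 1) := by
    simp [A, hBc, pow_succ]
  have hfib : ∀ q ∈ A, (((Fintype.piFinset fun _ : Fin k => dv (nn q)).image fun d => (q, d)).card : ℝ) ≤ (2 * C) ^ k * X ^ ε := by
    intro q hq
    simp only [A, Finset.mem_product, Fintype.mem_piFinset] at hq
    have h1 : (((Fintype.piFinset fun _ : Fin k => dv (nn q)).image fun d => (q, d)).card) ≤ (2 * (nn q).natAbs.divisors.card) ^ k := by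
      refine Finset.card_image_le.trans ?_
      rw [Fintype.card_piFinset, Finset.prod_const, Finset.card_univ, Fintype.card_fin]
      exact Nat.pow_le_pow_left (hdvc _) _
    have h2 : ((nn q).natAbs.divisors.card : ℝ) ≤ C * X ^ (ε / k) := by
      by_cases h0 : (nn q).natAbs = 0
      · rw [h0]; simp; positivity
      refine (hC _ h0).trans ?_
      gcongr
      have h3 : (nn q).natAbs ≤ N ^ k := by
        simp only [nn]
        have hm := map_prod Int.natAbsHom (fun i => q.2 - q.1 i) Finset.univ
        simp only [Int.natAbsHom_apply] at hm
        rw [hm]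
        calc _ ≤ ∏ i : Fin k, N := Finset.prod_le_prod' fun i _ => by
              have a1 := Finset.mem_Icc.1 (hq.1 i)
              have a2 := Finset.mem_Icc.1 hq.2
              omega
          _ = _ := by simp
      have h4 : ((nn q).natAbs : ℝ) ≤ X ^ k := by
        calc ((nn q).natAbs : ℝ) ≤ (N : ℝ) ^ k := by exact_mod_cast h3
          _ ≤ _ := by gcongr
      calc ((nn q).natAbs : ℝ) ^ (ε / k ^ 2) ≤ (X ^ k) ^ (ε / k ^ 2) := Real.rpow_le_rpow (by positivity) h4 (by positivity)
        _ = X ^ (ε / k) := by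
          rw [← Real.rpow_natCast, ← Real.rpow_mul hX0.le]
          congr 1; field_simp
    calc _ ≤ (2 * ((nn q).natAbs.divisors.card : ℝ)) ^ k := by exact_mod_cast h1
      _ ≤ (2 * (C * X ^ (ε / k))) ^ k := by gcongr
      _ = (2 * C) ^ k * X ^ ε := by
        rw [← mul_assoc, mul_pow, ← Real.rpow_natCast (X ^ _), ← Real.rpow_mul hX0.le]
        congr 2; field_simp
  have hEc : (E.card : ℝ) ≤ X ^ (k + 1) * ((2 * C) ^ k * X ^ ε) := by
    calc (E.card : ℝ) ≤ ∑ q ∈ A, (((Fintype.piFinset fun _ : Fin k => dv (nn q)).image fun d => (q, d)).card : ℝ) := by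
          exact_mod_cast Finset.card_biUnion_le
      _ ≤ ∑ q ∈ A, (2 * C) ^ k * X ^ ε := Finset.sum_le_sum hfib
      _ = (N : ℝ) ^ (k + 1) * ((2 * C) ^ k * X ^ ε) := by
        rw [Finset.sum_const, hAc, nsmul_eq_mul]; push_cast; rfl
      _ ≤ _ := by gcongr
  have hJle : J (k+1) k X ≤ N ^ (k+1) * (k+1).factorial + E.card := by
    rw [hJ, ← Set.inter_union_sdiff S D]
    refine (Set.ncard_union_le _ _).trans ?_
    omega
  have hpow : X ^ ((k : ℝ) + 1 + ε) = X ^ (k + 1) * X ^ ε := by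
    rw [Real.rpow_add hX0]
    congr 1
    exact_mod_cast Real.rpow_natCast X (k+1)
  calc (J (k + 1) k X : ℝ) ≤ (N : ℝ) ^ (k+1) * (k+1).factorial + E.card := by exact_mod_cast hJle
    _ ≤ X ^ (k+1) * (k+1).factorial * X ^ ε + X ^ (k + 1) * ((2 * C) ^ k * X ^ ε) := by
      refine add_le_add ?_ hEc
      refine le_trans ?_ (le_mul_of_one_le_right (by positivity) hXp)
      gcongr
    _ = _ := by rw [hpow]; ring
end
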